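/- arXiv:1601.01267 — 2 statements merged into one kernel-verified Lean document; each statement's English description precedes it below -/
import Mathlib

section
/- Let φ : (0,∞) → (0,∞) be a C¹ function satisfying (φ₁) and (φ₂), let Ω ⊂ ℝᴺ be a bounded open set, and let B : Ω × ℝ → ℝ be locally bounded and measurable, with t ↦ B(x,t) non-decreasing for each x ∈ Ω. Suppose u, v ∈ C¹(Ω) satisfy Δ_φ u ≥ B(x,u) and Δ_φ v ≤ B(x,v) weakly in Ω, i.e. for every nonnegative ψ ∈ C_c^∞(Ω): −∫_Ω φ(|∇u|)⟨∇u, ∇ψ⟩ dx ≥ ∫_Ω B(x,u(x))ψ dx and −∫_Ω φ(|∇v|)⟨∇v, ∇ψ⟩ dx ≤ ∫_Ω B(x,v(x))ψ dx. If u ≤ v on ∂Ω in the sense that for every δ > 0 there exists an open neighborhood U of ∂Ω such that u < v + δ on U ∩ Ω, then u ≤ v in Ω. -/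
open MeasureTheory Real Set Filter RealInnerProductSpace

section Gradient

variable {E : Type*} [NormedAddCommGroup E] [InnerProductSpace ℝ E] [CompleteSpace E]

lemma gradient_eq_zero_of_notMem_tsupport {ψ : E → ℝ} {x : E} (hx : x ∉ tsupport ψ) :
    gradient ψ x = 0 := by
  have : fderiv ℝ ψ x = 0 := by
    by_contra h
    exact hx (support_fderiv_subset ℝ h)
  simp [gradient, this]

lemma norm_gradient_sub (f g : E → ℝ) (x : E) :
    ‖gradient f x - gradient g x‖ = ‖fderiv ℝ f x - fderiv ℝ g x‖ := by
  rw [gradient, gradient, ← map_sub, LinearIsometryEquiv.norm_map]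

lemma ContDiff.continuous_gradient {ψ : E → ℝ} (hψ : ContDiff ℝ 1 ψ) :
    Continuous (gradient ψ) :=
  (InnerProductSpace.toDual ℝ E).symm.continuous.comp (hψ.continuous_fderiv one_ne_zero)

end Gradient

section Mollification

open scoped Convolution Topology

variable {E : Type*} [NormedAddCommGroup E] [InnerProductSpace ℝ E] [FiniteDimensional ℝ E]
  [MeasurableSpace E] [BorelSpace E]

/-- A nonnegative `C¹` function with compact support is approximated in the `C¹` norm by
nonnegative smooth functions supported in a small neighborhood of its support. -/
lemma exists_smooth_approx_of_contDiff_one {ψ : E → ℝ} (hψ : ContDiff ℝ 1 ψ) (hc : HasCompactSupport ψ)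
    (h0 : ∀ x, 0 ≤ ψ x) {ε δ : ℝ} (hε : 0 < ε) (hδ : 0 < δ) :
    ∃ g : E → ℝ, ContDiff ℝ (⊤ : ℕ∞) g ∧ tsupport g ⊆ Metric.cthickening δ (tsupport ψ) ∧
      (∀ x, 0 ≤ g x) ∧ (∀ x, ‖g x - ψ x‖ ≤ ε) ∧
      ∀ x, ‖fderiv ℝ g x - fderiv ℝ ψ x‖ ≤ ε := by
  have hψ' : Continuous (fderiv ℝ ψ) := hψ.continuous_fderiv one_ne_zero
  obtain ⟨r₁, hr₁, H₁⟩ := Metric.uniformContinuous_iff.1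
    (hc.uniformContinuous_of_continuous hψ.continuous) ε hε
  obtain ⟨r₂, hr₂, H₂⟩ := Metric.uniformContinuous_iff.1
    ((hc.fderiv ℝ).uniformContinuous_of_continuous hψ') ε hε
  set r := min δ (min r₁ r₂)
  have hr : 0 < r := by positivity
  let b : ContDiffBump (0 : E) := ⟨r / 2, r, by positivity, by linarith⟩
  have hbr : b.rOut = r := rfl
  set g : E → ℝ := (b.normed volume) ⋆[ContinuousLinearMap.lsmul ℝ ℝ, volume] ψ
  have hfd : ∀ x, fderiv ℝ g x =
      ((b.normed volume) ⋆[ContinuousLinearMap.lsmul ℝ ℝ, volume] (fderiv ℝ ψ)) x := by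
    intro x
    refine (hc.hasFDerivAt_convolution_right (ContinuousLinearMap.lsmul ℝ ℝ)
      b.integrable_normed.locallyIntegrable hψ x).fderiv.trans ?_
    unfold convolution
    congr 1
  refine ⟨g, ?_, ?_, ?_, ?_, ?_⟩
  · exact b.hasCompactSupport_normed.contDiff_convolution_left _ b.contDiff_normed
      hψ.continuous.locallyIntegrable
  · refine closure_minimal ?_ Metric.isClosed_cthickening
    refine (support_convolution_subset (ContinuousLinearMap.lsmul ℝ ℝ)).trans ?_
    rw [b.support_normed_eq, hbr]
    rintro _ ⟨x, hx, y, hy, rfl⟩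
    refine Metric.mem_cthickening_of_dist_le _ y _ _ (subset_tsupport _ hy) ?_
    have : ‖x‖ < r := by simpa using hx
    simpa using this.le.trans (min_le_left _ _)
  · intro x
    refine integral_nonneg fun t => ?_
    exact mul_nonneg (b.nonneg_normed t) (h0 _)
  · intro x
    rw [← dist_eq_norm]
    refine b.dist_normed_convolution_le hψ.continuous.aestronglyMeasurable fun y hy => ?_
    exact (H₁ ((Metric.mem_ball.1 hy).trans_le
      ((min_le_right _ _).trans (min_le_left _ _)))).le
  · intro x
    rw [← dist_eq_norm, hfd]
    refine b.dist_normed_convolution_le hψ'.aestronglyMeasurable fun y hy => ?_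
    exact (H₂ ((Metric.mem_ball.1 hy).trans_le
      ((min_le_right _ _).trans (min_le_right _ _)))).le

/-- A weak first-order differential inequality that holds against smooth nonnegative test functions
also holds against `C¹` ones. -/
lemma weak_le_of_forall_smooth {Ω : Set E} (hΩ : IsOpen Ω) {f : E → ℝ} {G : E → E}
    (hf : ∀ K ⊆ Ω, IsCompact K → IntegrableOn f K)
    (hG : ∀ K ⊆ Ω, IsCompact K → IntegrableOn G K)
    (h : ∀ ψ : E → ℝ, ContDiff ℝ (⊤ : ℕ∞) ψ → HasCompactSupport ψ → tsupport ψ ⊆ Ω →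
      (∀ x, 0 ≤ ψ x) → (∫ x in Ω, f x * ψ x) ≤ -∫ x in Ω, ⟪G x, gradient ψ x⟫)
    {ψ : E → ℝ} (hψ : ContDiff ℝ 1 ψ) (hc : HasCompactSupport ψ) (hs : tsupport ψ ⊆ Ω)
    (h0 : ∀ x, 0 ≤ ψ x) :
    (∫ x in Ω, f x * ψ x) ≤ -∫ x in Ω, ⟪G x, gradient ψ x⟫ := by
  obtain ⟨δ, hδ, hδΩ⟩ := hc.isCompact.exists_cthickening_subset_open hΩ hs
  set K := Metric.cthickening δ (tsupport ψ)
  have hK : IsCompact K := hc.isCompact.cthickening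
  have hψK : tsupport ψ ⊆ K := Metric.self_subset_cthickening _
  choose g hg hgK hg0 hgψ hgψ' using fun n : ℕ =>
    exists_smooth_approx_of_contDiff_one hψ hc h0 (ε := 1 / ((n : ℝ) + 1)) (by positivity) hδ
  have hn1 : ∀ n : ℕ, 1 / ((n : ℝ) + 1) ≤ 1 := fun n => by
    rw [div_le_one (by positivity)]; linarith [(n.cast_nonneg : (0 : ℝ) ≤ n)]
  have hgc : ∀ n, HasCompactSupport (g n) := fun n =>
    HasCompactSupport.of_support_subset_isCompact hK ((subset_tsupport _).trans (hgK n))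
  obtain ⟨M₁, hM₁⟩ := hc.exists_bound_of_continuous hψ.continuous
  obtain ⟨M₂, hM₂⟩ := (hc.fderiv ℝ).exists_bound_of_continuous (hψ.continuous_fderiv one_ne_zero)
  have hΩK₁ : ∀ χ : E → ℝ, tsupport χ ⊆ K → ∫ x in Ω, f x * χ x = ∫ x in K, f x * χ x := by
    intro χ hχ
    refine setIntegral_eq_of_subset_of_forall_sdiff_eq_zero hΩ.measurableSet hδΩ fun x hx => ?_
    rw [image_eq_zero_of_notMem_tsupport fun hx' => hx.2 (hχ hx'), mul_zero]
  have hΩK₂ : ∀ χ : E → ℝ, tsupport χ ⊆ K →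
      ∫ x in Ω, ⟪G x, gradient χ x⟫ = ∫ x in K, ⟪G x, gradient χ x⟫ := by
    intro χ hχ
    refine setIntegral_eq_of_subset_of_forall_sdiff_eq_zero hΩ.measurableSet hδΩ fun x hx => ?_
    rw [gradient_eq_zero_of_notMem_tsupport fun hx' => hx.2 (hχ hx'), inner_zero_right]
  have hlim₁ : Tendsto (fun n => ∫ x in K, f x * g n x) atTop (𝓝 (∫ x in K, f x * ψ x)) := by
    refine tendsto_integral_of_dominated_convergence (fun x => ‖f x‖ * (M₁ + 1)) ?_ ?_ ?_ ?_
    · exact fun n => (hf K hδΩ hK).aestronglyMeasurable.mul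
        (hg n).continuous.aestronglyMeasurable
    · exact (hf K hδΩ hK).norm.mul_const _
    · refine fun n => Eventually.of_forall fun x => ?_
      rw [norm_mul]
      gcongr
      calc ‖g n x‖ ≤ ‖ψ x‖ + ‖g n x - ψ x‖ := norm_le_norm_add_norm_sub' _ _
        _ ≤ M₁ + 1 := add_le_add (hM₁ x) ((hgψ n x).trans (hn1 n))
    · refine Eventually.of_forall fun x => Tendsto.const_mul _ ?_
      rw [tendsto_iff_norm_sub_tendsto_zero]
      exact squeeze_zero (fun _ => norm_nonneg _) (fun n => hgψ n x)
        tendsto_one_div_add_atTop_nhds_zero_nat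
  have hlim₂ : Tendsto (fun n => ∫ x in K, ⟪G x, gradient (g n) x⟫) atTop
      (𝓝 (∫ x in K, ⟪G x, gradient ψ x⟫)) := by
    refine tendsto_integral_of_dominated_convergence (fun x => ‖G x‖ * (M₂ + 1)) ?_ ?_ ?_ ?_
    · exact fun n => (hG K hδΩ hK).aestronglyMeasurable.inner
        ((hg n).of_le (by exact_mod_cast le_top)).continuous_gradient.aestronglyMeasurable
    · exact (hG K hδΩ hK).norm.mul_const _
    · refine fun n => Eventually.of_forall fun x => (norm_inner_le_norm _ _).trans ?_
      gcongr
      calc ‖gradient (g n) x‖ ≤ ‖gradient ψ x‖ + ‖gradient (g n) x - gradient ψ x‖ :=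
            norm_le_norm_add_norm_sub' _ _
        _ ≤ M₂ + 1 := by
          refine add_le_add ?_ ?_
          · simpa [gradient] using hM₂ x
          · rw [norm_gradient_sub]; exact (hgψ' n x).trans (hn1 n)
    · refine Eventually.of_forall fun x => Tendsto.inner tendsto_const_nhds ?_
      rw [tendsto_iff_norm_sub_tendsto_zero]
      exact squeeze_zero (fun _ => norm_nonneg _)
        (fun n => (norm_gradient_sub _ _ x).trans_le (hgψ' n x))
        tendsto_one_div_add_atTop_nhds_zero_nat
  rw [hΩK₁ ψ hψK, hΩK₂ ψ hψK]
  refine le_of_tendsto_of_tendsto' hlim₁ hlim₂.neg fun n => ?_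
  rw [← hΩK₁ _ (hgK n), ← hΩK₂ _ (hgK n)]
  exact h _ (hg n) (hgc n) ((hgK n).trans hδΩ) (hg0 n)

end Mollification

lemma isCompact_superlevel {E : Type*} [PseudoMetricSpace E] [ProperSpace E] {Ω : Set E}
    (hΩ : IsOpen Ω) (hbdd : Bornology.IsBounded Ω) {w : E → ℝ} (hw : ContinuousOn w Ω) {ε : ℝ}
    (h : ∃ U : Set E, IsOpen U ∧ frontier Ω ⊆ U ∧ ∀ x ∈ U ∩ Ω, w x < ε) :
    IsCompact {x ∈ Ω | ε ≤ w x} := by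
  obtain ⟨U, hU, hfr, hlt⟩ := h
  refine Metric.isCompact_of_isClosed_isBounded ?_ (hbdd.subset fun x hx => hx.1)
  have hcl : IsClosed (closure Ω \ U) := isClosed_closure.sdiff hU
  have hsub : closure Ω \ U ⊆ Ω := fun x hx => by
    by_contra hxΩ
    exact hx.2 (hfr ⟨hx.1, by rwa [hΩ.interior_eq]⟩)
  have : {x ∈ Ω | ε ≤ w x} = (closure Ω \ U) ∩ w ⁻¹' Ici ε := by
    ext x
    refine ⟨fun hx => ⟨⟨subset_closure hx.1, fun hxU => ?_⟩, hx.2⟩,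
      fun hx => ⟨hsub hx.1, hx.2⟩⟩
    exact (hlt x ⟨hxU, hx.1⟩).not_ge hx.2
  rw [this]
  exact (hw.mono hsub).preimage_isClosed_of_isClosed hcl isClosed_Ici

lemma hasDerivAt_expNegInvGlue (t : ℝ) :
    HasDerivAt expNegInvGlue (t⁻¹ ^ 2 * expNegInvGlue t) t := by
  simpa using expNegInvGlue.hasDerivAt_polynomial_eval_inv_mul 1 t

section RadialField

variable {E : Type*} [NormedAddCommGroup E] [InnerProductSpace ℝ E]

/-- The vector field `p ↦ φ(‖p‖) p` is strictly monotone when `t ↦ φ(t) t` is. -/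
lemma inner_radial_sub_pos {φ : ℝ → ℝ} (hpos : ∀ t > (0 : ℝ), 0 < φ t)
    (hmono : StrictMonoOn (fun t => φ t * t) (Ioi 0)) {p q : E} (hpq : p ≠ q) :
    0 < ⟪φ ‖p‖ • p - φ ‖q‖ • q, p - q⟫ := by
  have hexp : ⟪φ ‖p‖ • p - φ ‖q‖ • q, p - q⟫ =
      φ ‖p‖ * ‖p‖ ^ 2 + φ ‖q‖ * ‖q‖ ^ 2 - (φ ‖p‖ + φ ‖q‖) * ⟪p, q⟫ := by
    simp only [inner_sub_left, inner_sub_right, real_inner_smul_left,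
      real_inner_self_eq_norm_sq, real_inner_comm p q]
    ring
  rcases eq_or_ne p 0 with rfl | hp
  · have hq : 0 < ‖q‖ := norm_pos_iff.2 hpq.symm
    rw [hexp]
    simpa using mul_pos (hpos _ hq) (pow_pos hq 2)
  rcases eq_or_ne q 0 with rfl | hq
  · have hp : 0 < ‖p‖ := norm_pos_iff.2 hpq
    rw [hexp]
    simpa using mul_pos (hpos _ hp) (pow_pos hp 2)
  have ha : 0 < ‖p‖ := norm_pos_iff.2 hp
  have hb : 0 < ‖q‖ := norm_pos_iff.2 hq
  have hφa := hpos _ ha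
  have hφb := hpos _ hb
  rw [hexp]
  rcases eq_or_ne ‖p‖ ‖q‖ with hab | hab
  · have h1 : 0 < ‖p - q‖ ^ 2 := pow_pos (norm_pos_iff.2 (sub_ne_zero.2 hpq)) 2
    rw [norm_sub_sq_real, hab] at h1
    rw [hab]
    nlinarith
  · have h1 : 0 < (φ ‖p‖ * ‖p‖ - φ ‖q‖ * ‖q‖) * (‖p‖ - ‖q‖) := by
      rcases lt_or_gt_of_ne hab with h | h
      · exact mul_pos_of_neg_of_neg (sub_neg.2 (hmono ha hb h)) (sub_neg.2 h)
      · exact mul_pos (sub_pos.2 (hmono hb ha h)) (sub_pos.2 h)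
    have h2 : (φ ‖p‖ + φ ‖q‖) * ⟪p, q⟫ ≤ (φ ‖p‖ + φ ‖q‖) * (‖p‖ * ‖q‖) :=
      mul_le_mul_of_nonneg_left (real_inner_le_norm p q) (by positivity)
    nlinarith

lemma inner_radial_sub_nonneg {φ : ℝ → ℝ} (hpos : ∀ t > (0 : ℝ), 0 < φ t)
    (hmono : StrictMonoOn (fun t => φ t * t) (Ioi 0)) (p q : E) :
    0 ≤ ⟪φ ‖p‖ • p - φ ‖q‖ • q, p - q⟫ := by
  rcases eq_or_ne p q with rfl | hpq
  · simp
  · exact (inner_radial_sub_pos hpos hmono hpq).le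

lemma norm_radial_le {φ : ℝ → ℝ} (hpos : ∀ t > (0 : ℝ), 0 < φ t)
    (hmono : StrictMonoOn (fun t => φ t * t) (Ioi 0)) {p : E} {M : ℝ} (hM : 0 < M)
    (hp : ‖p‖ ≤ M) : ‖φ ‖p‖ • p‖ ≤ φ M * M := by
  rcases eq_or_ne p 0 with rfl | h
  · simpa using (mul_pos (hpos M hM) hM).le
  · have ha : 0 < ‖p‖ := norm_pos_iff.2 h
    rw [norm_smul, Real.norm_of_nonneg (hpos _ ha).le]
    exact hmono.monotoneOn ha hM hp

lemma measurable_radial [MeasurableSpace E] [BorelSpace E] [SecondCountableTopology E]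
    {φ : ℝ → ℝ} (hφ : ContinuousOn φ (Ioi 0)) :
    Measurable fun p : E => φ ‖p‖ • p := by
  have hφ' : Measurable ((Ioi (0 : ℝ)).indicator φ) := by
    classical
    rw [← piecewise_eq_indicator]
    exact hφ.measurable_piecewise continuousOn_const measurableSet_Ioi
  have : (fun p : E => φ ‖p‖ • p) = fun p : E => (Ioi (0 : ℝ)).indicator φ ‖p‖ • p := by
    funext p
    rcases eq_or_ne p 0 with rfl | h
    · simp
    · rw [indicator_of_mem (mem_Ioi.2 (norm_pos_iff.2 h))]
  rw [this]
  exact (hφ'.comp measurable_norm).smul measurable_id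

lemma ContDiffOn.continuousOn_gradient_of_isOpen [CompleteSpace E] {Ω : Set E} {u : E → ℝ}
    (hΩ : IsOpen Ω) (hu : ContDiffOn ℝ 1 u Ω) : ContinuousOn (gradient u) Ω :=
  (InnerProductSpace.toDual ℝ E).symm.continuous.comp_continuousOn
    (hu.continuousOn_fderiv_of_isOpen hΩ le_rfl)

variable [FiniteDimensional ℝ E] [MeasurableSpace E] [BorelSpace E]

lemma integrableOn_radial_gradient {φ : ℝ → ℝ} (hφ : ContinuousOn φ (Ioi 0))
    (hpos : ∀ t > (0 : ℝ), 0 < φ t) (hmono : StrictMonoOn (fun t => φ t * t) (Ioi 0))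
    {Ω : Set E} (hΩ : IsOpen Ω) {u : E → ℝ} (hu : ContDiffOn ℝ 1 u Ω)
    {K : Set E} (hKΩ : K ⊆ Ω) (hK : IsCompact K) :
    IntegrableOn (fun x => φ ‖gradient u x‖ • gradient u x) K := by
  have hcont : ContinuousOn (gradient u) K :=
    (hu.continuousOn_gradient_of_isOpen hΩ).mono hKΩ
  obtain ⟨M, hM⟩ := hK.exists_bound_of_continuousOn hcont
  refine IntegrableOn.of_bound hK.measure_lt_top ?_ (φ (|M| + 1) * (|M| + 1)) ?_
  · exact ((measurable_radial hφ).comp_aemeasurable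
      (hcont.aemeasurable hK.measurableSet)).aestronglyMeasurable
  · filter_upwards [ae_restrict_mem hK.measurableSet] with x hx
    exact norm_radial_le hpos hmono (by positivity)
      ((hM x hx).trans (by linarith [le_abs_self M]))

lemma integrableOn_nemytskii {Ω : Set E} {B : E → ℝ → ℝ}
    (hB : Measurable fun p : E × ℝ => B p.1 p.2)
    (hB_bdd : ∀ (K : Set E) (M : ℝ), IsCompact K → K ⊆ Ω →
      ∃ C : ℝ, ∀ x ∈ K, ∀ t : ℝ, |t| ≤ M → |B x t| ≤ C)
    {u : E → ℝ} (hu : ContinuousOn u Ω) {K : Set E} (hKΩ : K ⊆ Ω) (hK : IsCompact K) :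
    IntegrableOn (fun x => B x (u x)) K := by
  obtain ⟨M, hM⟩ := hK.exists_bound_of_continuousOn (hu.mono hKΩ)
  obtain ⟨C, hC⟩ := hB_bdd K M hK hKΩ
  refine IntegrableOn.of_bound hK.measure_lt_top ?_ C ?_
  · exact (hB.comp_aemeasurable (aemeasurable_id.prodMk
      ((hu.mono hKΩ).aemeasurable hK.measurableSet))).aestronglyMeasurable
  · filter_upwards [ae_restrict_mem hK.measurableSet] with x hx
    exact hC x hx _ (hM x hx)

end RadialField

section TestFunctions

open scoped Topology

variable {E : Type*} [NormedAddCommGroup E] [InnerProductSpace ℝ E]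

/-- The composition of `u - v` with a smooth function that vanishes exactly on `(-∞, ε]` is an
admissible `C¹` test function when `u < v + ε` near the boundary. -/
lemma expNegInvGlue_cutoff [FiniteDimensional ℝ E] {Ω : Set E} (hΩ : IsOpen Ω)
    (hbdd : Bornology.IsBounded Ω) {u v : E → ℝ} (hu : ContDiffOn ℝ 1 u Ω)
    (hv : ContDiffOn ℝ 1 v Ω) {ε : ℝ}
    (h : ∃ U : Set E, IsOpen U ∧ frontier Ω ⊆ U ∧ ∀ x ∈ U ∩ Ω, u x - v x < ε) :
    let ψ := Ω.indicator fun x => expNegInvGlue (u x - v x - ε)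
    ContDiff ℝ 1 ψ ∧ tsupport ψ ⊆ Ω ∧ HasCompactSupport ψ ∧
      ∀ x ∈ Ω, gradient ψ x = ((u x - v x - ε)⁻¹ ^ 2 * expNegInvGlue (u x - v x - ε)) •
        (gradient u x - gradient v x) := by
  intro ψ
  have hK := isCompact_superlevel hΩ hbdd (hu.continuousOn.sub hv.continuousOn) h
  set K := {x ∈ Ω | ε ≤ u x - v x}
  have hsupp : Function.support ψ ⊆ K := by
    intro x hx
    have hxΩ : x ∈ Ω := mem_of_indicator_ne_zero hx
    have hx' : expNegInvGlue (u x - v x - ε) ≠ 0 := fun h0 =>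
      hx ((indicator_of_mem hxΩ _).trans h0)
    rw [Ne, expNegInvGlue.zero_iff_nonpos] at hx'
    exact ⟨hxΩ, by linarith⟩
  have htsupp : tsupport ψ ⊆ K := closure_minimal hsupp hK.isClosed
  have hloc : ∀ x ∈ Ω, ψ =ᶠ[𝓝 x] fun x => expNegInvGlue (u x - v x - ε) := fun x hx => by
    filter_upwards [hΩ.mem_nhds hx] with y hy using indicator_of_mem hy _
  refine ⟨contDiff_iff_contDiffAt.2 fun x => ?_, htsupp.trans fun x hx => hx.1,
    .of_support_subset_isCompact hK hsupp, fun x hx => ?_⟩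
  · by_cases hx : x ∈ Ω
    · refine ContDiffAt.congr_of_eventuallyEq ?_ (hloc x hx)
      exact (expNegInvGlue.contDiff (n := 1)).contDiffAt.comp x
        (((hu.contDiffAt (hΩ.mem_nhds hx)).sub (hv.contDiffAt (hΩ.mem_nhds hx))).sub
          contDiffAt_const)
    · refine (contDiffAt_const (c := (0 : ℝ))).congr_of_eventuallyEq ?_
      exact notMem_tsupport_iff_eventuallyEq.1 fun h => hx (htsupp h).1
  · have hu' := ((hu.differentiableOn one_ne_zero).differentiableAt (hΩ.mem_nhds hx)).hasFDerivAt
    have hv' := ((hv.differentiableOn one_ne_zero).differentiableAt (hΩ.mem_nhds hx)).hasFDerivAt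
    have hw := (hasDerivAt_expNegInvGlue (u x - v x - ε)).comp_hasFDerivAt x
      ((hu'.sub hv').sub_const ε)
    have hfd := (hw.congr_of_eventuallyEq (hloc x hx)).fderiv
    rw [gradient, gradient, gradient, hfd, ← map_sub]
    simp

variable [FiniteDimensional ℝ E] [MeasurableSpace E] [BorelSpace E] {Ω : Set E} {ψ : E → ℝ}

lemma integrableOn_mul_of_tsupport (hΩ : MeasurableSet Ω) (hψ : Continuous ψ)
    (hc : HasCompactSupport ψ) (hs : tsupport ψ ⊆ Ω) {f : E → ℝ}
    (hf : ∀ K ⊆ Ω, IsCompact K → IntegrableOn f K) :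
    IntegrableOn (fun x => f x * ψ x) Ω := by
  obtain ⟨M, hM⟩ := hc.exists_bound_of_continuous hψ
  refine IntegrableOn.of_forall_sdiff_eq_zero (s := tsupport ψ) ?_ hΩ fun x hx => ?_
  · exact (hf _ hs hc.isCompact).mul_bdd hψ.aestronglyMeasurable (.of_forall hM)
  · rw [image_eq_zero_of_notMem_tsupport hx.2, mul_zero]

lemma integrableOn_inner_gradient_of_tsupport (hΩ : MeasurableSet Ω) (hψ : ContDiff ℝ 1 ψ)
    (hc : HasCompactSupport ψ) (hs : tsupport ψ ⊆ Ω) {G : E → E}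
    (hG : ∀ K ⊆ Ω, IsCompact K → IntegrableOn G K) :
    IntegrableOn (fun x => ⟪G x, gradient ψ x⟫) Ω := by
  obtain ⟨M, hM⟩ := (hc.fderiv ℝ).exists_bound_of_continuous (hψ.continuous_fderiv one_ne_zero)
  have hG' := hG _ hs hc.isCompact
  refine IntegrableOn.of_forall_sdiff_eq_zero (s := tsupport ψ) ?_ hΩ fun x hx => ?_
  · refine (hG'.norm.mul_const M).mono'
      (hG'.aestronglyMeasurable.inner hψ.continuous_gradient.aestronglyMeasurable)
      (.of_forall fun x => (norm_inner_le_norm _ _).trans ?_)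
    gcongr
    simpa [gradient] using hM x
  · rw [gradient_eq_zero_of_notMem_tsupport hx.2, inner_zero_right]

end TestFunctions

/-- Lemma 2.3, comparison principle: under (φ₁)-(φ₂), if
Δ_φ u ≥ B(x,u) and Δ_φ v ≤ B(x,v) weakly in a bounded open set Ω, with B locally
bounded, measurable and non-decreasing in its second variable, and u ≤ v on ∂Ω
(in the sense that for every δ > 0 there is a neighborhood of ∂Ω where u < v + δ),
then u ≤ v in Ω. -/
theorem stmt6
    (N : ℕ) (hN : 1 ≤ N)
    (φ Φ : ℝ → ℝ)
    (hφC1 : ContDiffOn ℝ 1 φ (Set.Ioi 0))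
    (hφpos : ∀ t > (0:ℝ), 0 < φ t)
    (hΦ : ∀ t : ℝ, Φ t = ∫ s in (0:ℝ)..|t|, φ s * s)
    (hφ1 : ∀ t > (0:ℝ), 0 < deriv (fun s => φ s * s) t)
    (l m : ℝ) (hl : 1 < l) (hm : 1 < m)
    (hφ2 : ∀ t > (0:ℝ), l ≤ φ t * t ^ 2 / Φ t ∧ φ t * t ^ 2 / Φ t ≤ m)
    (Ω : Set (EuclideanSpace ℝ (Fin N)))
    (hΩ_open : IsOpen Ω) (hΩ_bdd : Bornology.IsBounded Ω)
    (B : EuclideanSpace ℝ (Fin N) → ℝ → ℝ)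
    (hB_meas : Measurable (fun p : EuclideanSpace ℝ (Fin N) × ℝ => B p.1 p.2))
    (hB_locbdd : ∀ (K : Set (EuclideanSpace ℝ (Fin N))) (M : ℝ), IsCompact K → K ⊆ Ω →
      ∃ C : ℝ, ∀ x ∈ K, ∀ t : ℝ, |t| ≤ M → |B x t| ≤ C)
    (hB_mono : ∀ x ∈ Ω, Monotone (B x))
    (u v : EuclideanSpace ℝ (Fin N) → ℝ)
    (hu : ContDiffOn ℝ 1 u Ω) (hv : ContDiffOn ℝ 1 v Ω)
    (hu_sub : ∀ ψ : EuclideanSpace ℝ (Fin N) → ℝ, ContDiff ℝ (⊤ : ℕ∞) ψ → HasCompactSupport ψ →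
      tsupport ψ ⊆ Ω → (∀ x, 0 ≤ ψ x) →
      (∫ x in Ω, B x (u x) * ψ x) ≤
        -(∫ x in Ω, φ ‖gradient u x‖ * ⟪gradient u x, gradient ψ x⟫))
    (hv_super : ∀ ψ : EuclideanSpace ℝ (Fin N) → ℝ, ContDiff ℝ (⊤ : ℕ∞) ψ → HasCompactSupport ψ →
      tsupport ψ ⊆ Ω → (∀ x, 0 ≤ ψ x) →
      -(∫ x in Ω, φ ‖gradient v x‖ * ⟪gradient v x, gradient ψ x⟫) ≤
        ∫ x in Ω, B x (v x) * ψ x)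
    (h_bdry : ∀ δ > (0:ℝ), ∃ U : Set (EuclideanSpace ℝ (Fin N)),
      IsOpen U ∧ frontier Ω ⊆ U ∧ ∀ x ∈ U ∩ Ω, u x < v x + δ) :
    ∀ x ∈ Ω, u x ≤ v x := by
  have hmono : StrictMonoOn (fun t => φ t * t) (Ioi 0) := by
    refine strictMonoOn_of_deriv_pos (convex_Ioi 0) (hφC1.continuousOn.mul continuousOn_id) ?_
    rw [interior_Ioi]
    exact fun t ht => hφ1 t ht
  by_contra! hcon
  obtain ⟨x₀, hx₀, hlt⟩ := hcon
  set ε := (u x₀ - v x₀) / 2 with hε_def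
  have hε : 0 < ε := by rw [hε_def]; linarith
  obtain ⟨hψ, hψK, hψcomp, hψgrad⟩ := expNegInvGlue_cutoff hΩ_open hΩ_bdd hu hv
    (by simpa only [sub_lt_iff_lt_add'] using h_bdry ε hε)
  set ψ := Ω.indicator fun x => expNegInvGlue (u x - v x - ε)
  have hψΩ : ∀ x ∈ Ω, ψ x = expNegInvGlue (u x - v x - ε) := fun x hx => indicator_of_mem hx _
  have hψ0 : ∀ x, 0 ≤ ψ x := indicator_nonneg fun x _ => expNegInvGlue.nonneg _
  have hfu := fun K (hKΩ : K ⊆ Ω) hK =>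
    integrableOn_nemytskii hB_meas hB_locbdd hu.continuousOn hKΩ hK
  have hfv := fun K (hKΩ : K ⊆ Ω) hK =>
    integrableOn_nemytskii hB_meas hB_locbdd hv.continuousOn hKΩ hK
  have hGu := fun K (hKΩ : K ⊆ Ω) hK =>
    integrableOn_radial_gradient hφC1.continuousOn hφpos hmono hΩ_open hu hKΩ hK
  have hGv := fun K (hKΩ : K ⊆ Ω) hK =>
    integrableOn_radial_gradient hφC1.continuousOn hφpos hmono hΩ_open hv hKΩ hK
  have hweak := weak_le_of_forall_smooth hΩ_open hfu hGu
    (by simpa only [real_inner_smul_left] using hu_sub) hψ hψcomp hψK hψ0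
  have hweak' := weak_le_of_forall_smooth hΩ_open (fun K hKΩ hK => (hfv K hKΩ hK).neg)
    (fun K hKΩ hK => (hGv K hKΩ hK).neg)
    (by
      intro χ h1 h2 h3 h4
      have := hv_super χ h1 h2 h3 h4
      simp only [Pi.neg_apply, neg_mul, inner_neg_left, integral_neg, real_inner_smul_left]
      linarith) hψ hψcomp hψK hψ0
  simp only [Pi.neg_apply, neg_mul, inner_neg_left, integral_neg, neg_neg] at hweak'
  have hBle : ∫ x in Ω, B x (v x) * ψ x ≤ ∫ x in Ω, B x (u x) * ψ x := by
    have hΩ_meas := hΩ_open.measurableSet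
    refine setIntegral_mono_on
      (integrableOn_mul_of_tsupport hΩ_meas hψ.continuous hψcomp hψK hfv)
      (integrableOn_mul_of_tsupport hΩ_meas hψ.continuous hψcomp hψK hfu) hΩ_meas
      fun x hx => ?_
    rcases le_or_gt (u x - v x - ε) 0 with h | h
    · simp [hψΩ x hx, expNegInvGlue.zero_of_nonpos h]
    · exact mul_le_mul_of_nonneg_right (hB_mono x hx (by linarith)) (hψ0 x)
  have hIu := integrableOn_inner_gradient_of_tsupport hΩ_open.measurableSet hψ hψcomp hψK hGu
  have hIv := integrableOn_inner_gradient_of_tsupport hΩ_open.measurableSet hψ hψcomp hψK hGv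
  have hint : ∫ x in Ω, (⟪φ ‖gradient u x‖ • gradient u x, gradient ψ x⟫ -
      ⟪φ ‖gradient v x‖ • gradient v x, gradient ψ x⟫) ≤ 0 := by
    rw [integral_sub hIu hIv]
    linarith
  have hform : ∀ x ∈ Ω, ⟪φ ‖gradient u x‖ • gradient u x, gradient ψ x⟫ -
      ⟪φ ‖gradient v x‖ • gradient v x, gradient ψ x⟫ =
      ((u x - v x - ε)⁻¹ ^ 2 * expNegInvGlue (u x - v x - ε)) *
      ⟪φ ‖gradient u x‖ • gradient u x - φ ‖gradient v x‖ • gradient v x,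
        gradient u x - gradient v x⟫ := fun x hx => by
    rw [← inner_sub_left, hψgrad x hx, real_inner_smul_right]
  have hnonneg : ∀ᵐ x ∂volume.restrict Ω,
      0 ≤ ⟪φ ‖gradient u x‖ • gradient u x, gradient ψ x⟫ -
        ⟪φ ‖gradient v x‖ • gradient v x, gradient ψ x⟫ := by
    filter_upwards [ae_restrict_mem hΩ_open.measurableSet] with x hx
    rw [hform x hx]
    exact mul_nonneg (mul_nonneg (sq_nonneg _) (expNegInvGlue.nonneg _))
      (inner_radial_sub_nonneg hφpos hmono _ _)
  have hzero := (integral_eq_zero_iff_of_nonneg_ae hnonneg (hIu.sub hIv)).1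
    (hint.antisymm (integral_nonneg_of_ae hnonneg))
  have hgrad : gradient ψ = 0 := by
    refine (hψ.continuous_gradient.ae_eq_iff_eq (μ := volume) continuous_zero).1 ?_
    filter_upwards [(ae_restrict_iff' hΩ_open.measurableSet).1 hzero] with x hx
    by_cases hxΩ : x ∈ Ω
    · have h := hx hxΩ
      simp only [hform x hxΩ, Pi.zero_apply] at h
      rw [hψgrad x hxΩ]
      rcases mul_eq_zero.1 h with h | h
      · rw [h, zero_smul, Pi.zero_apply]
      · have : gradient u x = gradient v x := by
          by_contra hne
          exact (inner_radial_sub_pos hφpos hmono hne).ne' h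
        simp [this]
    · exact gradient_eq_zero_of_notMem_tsupport fun h => hxΩ (hψK h)
  have hconst : ∀ x, ψ x = ψ x₀ := fun x =>
    is_const_of_fderiv_eq_zero (𝕜 := ℝ) (hψ.differentiable one_ne_zero)
      (fun y => by rw [← toDual_gradient, hgrad]; simp) x x₀
  have hψx₀ : 0 < ψ x₀ := by
    rw [hψΩ x₀ hx₀]
    exact expNegInvGlue.pos_of_pos (by rw [hε_def]; linarith)
  have : Nonempty (Fin N) := ⟨⟨0, hN⟩⟩
  refine NormedSpace.unbounded_univ ℝ (EuclideanSpace ℝ (Fin N)) (hΩ_bdd.subset fun x _ => ?_)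
  exact hψK (subset_tsupport _ (by rw [Function.mem_support, hconst x]; exact hψx₀.ne'))
end

section
/- Let φ : (0,∞) → (0,∞) be a C¹ function satisfying (φ₁)–(φ₃), let N ≥ 1 and R > 0, let a be a positive, continuous, radially symmetric function on the closed ball B̄_R(0) ⊂ ℝᴺ, and let f : [0,∞) → [0,∞) be continuous with f(0) = 0, f(s) > 0 for s > 0, satisfying liminf_{s→∞} (inf{f(t) : t ≥ s})/f(s) > 0 and the φ-Keller–Osserman condition ∫₁^∞ dt/Φ⁻¹(F(t)) < ∞, F(t) = ∫₀^t f. Then there exists a radially symmetric function u ∈ C¹(B_R(0)), u ≥ 0, which is a weak solution of Δ_φ u = a(x)·f(u) in B_R(0) (i.e. ∫ φ(|∇u|)⟨∇u, ∇ψ⟩ dx + ∫ a f(u) ψ dx = 0 for all ψ ∈ C_c^∞(B_R(0))), such that u(x) → ∞ as |x| → R, and whose radial profile w (u(x) = w(|x|)) satisfies w'(0) = 0 and w'(r) ≥ 0 for 0 < r < R. -/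
open MeasureTheory Real Set Filter RealInnerProductSpace

namespace RadialBlowUp

/-- The weighted mean `∫₀¹ θ^d k(sθ) dθ`. -/
noncomputable def radialMean (d : ℕ) (k : ℝ → ℝ) (s : ℝ) : ℝ :=
  ∫ θ in (0:ℝ)..1, θ ^ d * k (s * θ)

/-- The radial flux, equal to `s^(-d) ∫₀ˢ t^d k(t) dt` for `s ≠ 0`. -/
noncomputable def flux (d : ℕ) (k : ℝ → ℝ) (s : ℝ) : ℝ := s * radialMean d k s

theorem continuous_radialMean_uncurry {X : Type*} [TopologicalSpace X] [FirstCountableTopology X]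
    (d : ℕ) {k : X → ℝ → ℝ} (hk : Continuous (Function.uncurry k)) {σ : X → ℝ}
    (hσ : Continuous σ) : Continuous fun x => radialMean d (k x) (σ x) := by
  unfold radialMean
  refine intervalIntegral.continuous_parametric_intervalIntegral_of_continuous'
    (f := fun x θ => θ ^ d * k x (σ x * θ)) ?_ 0 1
  have : Continuous fun p : X × ℝ => p.2 ^ d * Function.uncurry k (p.1, σ p.1 * p.2) := by
    fun_prop
  exact this

theorem continuous_flux_uncurry {X : Type*} [TopologicalSpace X] [FirstCountableTopology X]
    (d : ℕ) {k : X → ℝ → ℝ} (hk : Continuous (Function.uncurry k)) {σ : X → ℝ}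
    (hσ : Continuous σ) : Continuous fun x => flux d (k x) (σ x) :=
  hσ.mul (continuous_radialMean_uncurry d hk hσ)

theorem continuous_radialMean (d : ℕ) {k : ℝ → ℝ} (hk : Continuous k) :
    Continuous (radialMean d k) :=
  continuous_radialMean_uncurry d (k := fun _ => k) (hk.comp continuous_snd) continuous_id

theorem continuous_flux (d : ℕ) {k : ℝ → ℝ} (hk : Continuous k) : Continuous (flux d k) :=
  continuous_id.mul (continuous_radialMean d hk)

theorem radialMean_nonneg (d : ℕ) {k : ℝ → ℝ} (hk : ∀ t, 0 ≤ k t) (s : ℝ) :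
    0 ≤ radialMean d k s := by
  refine intervalIntegral.integral_nonneg zero_le_one fun θ hθ => ?_
  exact mul_nonneg (pow_nonneg hθ.1 _) (hk _)

theorem flux_nonneg (d : ℕ) {k : ℝ → ℝ} (hk : ∀ t, 0 ≤ k t) {s : ℝ} (hs : 0 ≤ s) :
    0 ≤ flux d k s := mul_nonneg hs (radialMean_nonneg d hk s)

theorem flux_nonpos (d : ℕ) {k : ℝ → ℝ} (hk : ∀ t, 0 ≤ k t) {s : ℝ} (hs : s ≤ 0) :
    flux d k s ≤ 0 := mul_nonpos_of_nonpos_of_nonneg hs (radialMean_nonneg d hk s)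

theorem radialMean_congr (d : ℕ) {k k' : ℝ → ℝ} {T s : ℝ} (hT : 0 ≤ T) (hs : s ≤ T)
    (h : ∀ t ≤ T, k t = k' t) : radialMean d k s = radialMean d k' s := by
  refine intervalIntegral.integral_congr fun θ hθ => ?_
  rw [uIcc_of_le zero_le_one] at hθ
  have : s * θ ≤ T := by
    rcases le_total s 0 with h0 | h0
    · nlinarith [hθ.1]
    · nlinarith [hθ.2]
  simp only [h _ this]

theorem flux_congr (d : ℕ) {k k' : ℝ → ℝ} {T s : ℝ} (hT : 0 ≤ T) (hs : s ≤ T)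
    (h : ∀ t ≤ T, k t = k' t) : flux d k s = flux d k' s := by
  rw [flux, flux, radialMean_congr d hT hs h]

theorem flux_le (d : ℕ) {k : ℝ → ℝ} (hk : Continuous k) {K s : ℝ} (hs : 0 ≤ s) (hK : 0 ≤ K)
    (h : ∀ t ∈ Icc 0 s, k t ≤ K) : flux d k s ≤ s * K := by
  refine mul_le_mul_of_nonneg_left ?_ hs
  have : radialMean d k s ≤ ∫ _θ in (0:ℝ)..1, K := by
    refine intervalIntegral.integral_mono_on zero_le_one
      (Continuous.intervalIntegrable (by fun_prop) _ _) (by simp) fun θ hθ => ?_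
    have h1 : θ ^ d ≤ 1 := pow_le_one₀ hθ.1 hθ.2
    have h2 : k (s * θ) ≤ K := h _ ⟨mul_nonneg hs hθ.1, by nlinarith [hθ.2]⟩
    have h3 : (0:ℝ) ≤ θ ^ d := pow_nonneg hθ.1 _
    nlinarith
  simpa using this

theorem pow_mul_flux (d : ℕ) (k : ℝ → ℝ) (s : ℝ) :
    s ^ d * flux d k s = ∫ t in (0:ℝ)..s, t ^ d * k t := by
  have := intervalIntegral.mul_integral_comp_mul_left (a := 0) (b := 1)
    (f := fun t => t ^ d * k t) s
  rw [mul_zero, mul_one] at this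
  rw [← this, flux, radialMean, mul_left_comm, ← intervalIntegral.integral_const_mul]
  congr 1
  refine intervalIntegral.integral_congr fun θ _ => ?_
  simp only [mul_pow]; ring

theorem le_flux (d : ℕ) {k : ℝ → ℝ} (hk : Continuous k) (hk0 : ∀ t, 0 ≤ k t)
    {r₀ r₁ s R κ : ℝ} (hr₀ : 0 < r₀) (h01 : r₀ ≤ r₁) (h1s : r₁ ≤ s) (hsR : s ≤ R) (hκ : 0 ≤ κ)
    (h : ∀ t ∈ Icc r₁ s, κ ≤ k t) : (r₀ / R) ^ d * κ * (s - r₁) ≤ flux d k s := by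
  have hs : 0 < s := by linarith
  have hR : 0 < R := by linarith
  have hintegrable : ∀ a b, IntervalIntegrable (fun t => t ^ d * k t) volume a b := fun a b =>
    Continuous.intervalIntegrable (by fun_prop) _ _
  have h1 : r₀ ^ d * κ * (s - r₁) ≤ s ^ d * flux d k s := by
    rw [pow_mul_flux, ← intervalIntegral.integral_add_adjacent_intervals (hintegrable 0 r₁)
      (hintegrable r₁ s)]
    have hA : 0 ≤ ∫ t in (0:ℝ)..r₁, t ^ d * k t :=
      intervalIntegral.integral_nonneg (by linarith) fun t ht =>
        mul_nonneg (pow_nonneg ht.1 _) (hk0 _)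
    have hB : ∫ _t in r₁..s, r₀ ^ d * κ ≤ ∫ t in r₁..s, t ^ d * k t := by
      refine intervalIntegral.integral_mono_on h1s (by simp) (hintegrable _ _) fun t ht => ?_
      exact mul_le_mul (pow_le_pow_left₀ hr₀.le (by linarith [ht.1]) _) (h t ht) hκ
        (pow_nonneg (by linarith [ht.1]) _)
    simp only [intervalIntegral.integral_const, smul_eq_mul] at hB
    linarith
  have hq : 0 ≤ flux d k s := flux_nonneg d hk0 hs.le
  have h2 : s ^ d * flux d k s ≤ R ^ d * flux d k s := by gcongr
  rw [div_pow]
  have hRd : 0 < R ^ d := by positivity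
  rw [div_mul_eq_mul_div, div_mul_eq_mul_div, div_le_iff₀ hRd]
  linarith

/-- Standing assumptions on the weight `b`, the nonlinearity `f` and the inverse `H` of
`t ↦ φ(t)t`, all extended to the real line. -/
structure RadialData (b f H : ℝ → ℝ) : Prop where
  b_cont : Continuous b
  b_nonneg : ∀ t, 0 ≤ b t
  f_cont : Continuous f
  f_nonneg : ∀ t, 0 ≤ f t
  f_zero : f 0 = 0
  H_cont : Continuous H
  H_mono : Monotone H
  H_nonpos : ∀ y ≤ 0, H y = 0

/-- The slope of `w` is `H(flux)`, in integrated form on `(-∞, T]`, the nonlinearity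
being evaluated along `z`. -/
def IsRadialSol (d : ℕ) (b f H : ℝ → ℝ) (T : ℝ) (z w : ℝ → ℝ) : Prop :=
  ∀ r ≤ T, w r = w 0 + ∫ s in (0:ℝ)..r, H (flux d (fun t => b t * f (z t)) s)

namespace RadialData

variable {d : ℕ} {b f H : ℝ → ℝ}

theorem H_nonneg (D : RadialData b f H) (y : ℝ) : 0 ≤ H y := by
  rcases le_total y 0 with h | h
  · exact (D.H_nonpos y h).ge
  · rw [← D.H_nonpos 0 le_rfl]; exact D.H_mono h

theorem source_nonneg (D : RadialData b f H) (z : ℝ → ℝ) (t : ℝ) : 0 ≤ b t * f (z t) :=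
  mul_nonneg (D.b_nonneg t) (D.f_nonneg _)

theorem continuous_slope (D : RadialData b f H) {z : ℝ → ℝ} (hz : Continuous z) :
    Continuous fun s => H (flux d (fun t => b t * f (z t)) s) :=
  D.H_cont.comp (continuous_flux d (D.b_cont.mul (D.f_cont.comp hz)))

theorem slope_eq_zero (D : RadialData b f H) (z : ℝ → ℝ) {s : ℝ} (hs : s ≤ 0) :
    H (flux d (fun t => b t * f (z t)) s) = 0 :=
  D.H_nonpos _ (flux_nonpos d (D.source_nonneg z) hs)

theorem sub_eq_integral (D : RadialData b f H) {T : ℝ} {z w : ℝ → ℝ} (hz : Continuous z)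
    (hw : IsRadialSol d b f H T z w) {x y : ℝ} (hx : x ≤ T) (hy : y ≤ T) :
    w y - w x = ∫ s in x..y, H (flux d (fun t => b t * f (z t)) s) := by
  have hi : ∀ p q, IntervalIntegrable (fun s => H (flux d (fun t => b t * f (z t)) s)) volume p q :=
    fun p q => (D.continuous_slope hz).intervalIntegrable _ _
  rw [hw y hy, hw x hx, ← intervalIntegral.integral_interval_sub_left (hi 0 y) (hi 0 x)]
  ring

theorem mono_of_sol (D : RadialData b f H) {T : ℝ} {z w : ℝ → ℝ} (hz : Continuous z)
    (hw : IsRadialSol d b f H T z w) {x y : ℝ} (hxy : x ≤ y) (hy : y ≤ T) : w x ≤ w y := by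
  have := D.sub_eq_integral hz hw (hxy.trans hy) hy
  have h0 : 0 ≤ ∫ s in x..y, H (flux d (fun t => b t * f (z t)) s) :=
    intervalIntegral.integral_nonneg hxy fun s _ => D.H_nonneg _
  linarith

theorem const_of_sol (D : RadialData b f H) {T : ℝ} {z w : ℝ → ℝ}
    (hw : IsRadialSol d b f H T z w) {x : ℝ} (hx : x ≤ 0) (hxT : x ≤ T) : w x = w 0 := by
  rw [hw x hxT, intervalIntegral.integral_symm,
    intervalIntegral.integral_congr (g := fun _ => 0), intervalIntegral.integral_zero]
  · simp
  · intro s hs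
    rw [uIcc_of_le hx] at hs
    exact D.slope_eq_zero z hs.2

theorem slope_le (D : RadialData b f H) {z : ℝ → ℝ} (hz : Continuous z) {R A M T B s : ℝ}
    (hTR : T ≤ R) (hA : ∀ t, b t ≤ A) (hM : ∀ t ∈ Icc 0 B, f t ≤ M)
    (hB : ∀ t ∈ Icc 0 T, z t ∈ Icc 0 B) (hs : s ≤ T) :
    H (flux d (fun t => b t * f (z t)) s) ≤ H (R * (A * M)) := by
  rcases le_total s 0 with h0 | h0
  · rw [D.slope_eq_zero z h0]; exact D.H_nonneg _
  · have hM0 : 0 ≤ M := (D.f_nonneg _).trans (hM _ (hB 0 ⟨le_rfl, h0.trans hs⟩))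
    have hA0 : 0 ≤ A := (D.b_nonneg 0).trans (hA 0)
    refine D.H_mono ((flux_le d (D.b_cont.mul (D.f_cont.comp hz)) h0
      (mul_nonneg hA0 hM0) fun t ht => ?_).trans ?_)
    · exact mul_le_mul (hA t) (hM _ (hB t ⟨ht.1, ht.2.trans hs⟩)) (D.f_nonneg _) hA0
    · exact mul_le_mul_of_nonneg_right (hs.trans hTR) (mul_nonneg hA0 hM0)

theorem lipschitz_of_sol (D : RadialData b f H) {z w : ℝ → ℝ} (hz : Continuous z)
    {R A M T B x y : ℝ} (hTR : T ≤ R) (hA : ∀ t, b t ≤ A) (hM : ∀ t ∈ Icc 0 B, f t ≤ M)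
    (hB : ∀ t ∈ Icc 0 T, z t ∈ Icc 0 B) (hw : IsRadialSol d b f H T z w)
    (hx : x ≤ T) (hy : y ≤ T) : |w y - w x| ≤ H (R * (A * M)) * |y - x| := by
  rw [D.sub_eq_integral hz hw hx hy, ← Real.norm_eq_abs]
  refine intervalIntegral.norm_integral_le_of_norm_le_const fun s hs => ?_
  rw [Real.norm_of_nonneg (D.H_nonneg _)]
  refine D.slope_le hz hTR hA hM hB ?_
  rcases le_total x y with h | h
  · rw [uIoc_of_le h] at hs; exact hs.2.trans hy
  · rw [uIoc_of_ge h] at hs; exact hs.2.trans hx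

end RadialData

/-- Successive approximations of the equation with delay `ε` and initial value `α`. They become
stationary on `(-∞, jε]` after `j` steps. -/
noncomputable def delayIter (d : ℕ) (b f H : ℝ → ℝ) (ε : ℝ) : ℕ → ℝ → ℝ → ℝ
  | 0, α, _ => α
  | j + 1, α, r =>
    α + ∫ s in (0:ℝ)..r, H (flux d (fun t => b t * f (delayIter d b f H ε j α (t - ε))) s)

namespace RadialData

variable {d : ℕ} {b f H : ℝ → ℝ}

theorem continuous_delayIter (D : RadialData b f H) (ε : ℝ) (j : ℕ) :
    Continuous fun p : ℝ × ℝ => delayIter d b f H ε j p.1 p.2 := by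
  induction j with
  | zero => exact continuous_fst
  | succ j ih =>
    refine continuous_fst.add ?_
    refine intervalIntegral.continuous_parametric_intervalIntegral_of_continuous
      (f := fun (p : ℝ × ℝ) s =>
        H (flux d (fun t => b t * f (delayIter d b f H ε j p.1 (t - ε))) s)) ?_ continuous_snd
    refine D.H_cont.comp ?_
    refine continuous_flux_uncurry d (X := (ℝ × ℝ) × ℝ)
      (k := fun q t => b t * f (delayIter d b f H ε j q.1.1 (t - ε))) ?_ continuous_snd
    have h1 : Continuous fun q : ((ℝ × ℝ) × ℝ) × ℝ => (q.1.1.1, q.2 - ε) := by fun_prop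
    exact (D.b_cont.comp continuous_snd).mul (D.f_cont.comp (ih.comp h1))

theorem delayIter_zero (D : RadialData b f H) (ε : ℝ) (j : ℕ) (r : ℝ) :
    delayIter d b f H ε j 0 r = 0 := by
  induction j generalizing r with
  | zero => rfl
  | succ j ih =>
    simp only [delayIter, ih, D.f_zero, mul_zero]
    have : ∀ s, flux d (fun _ => (0:ℝ)) s = 0 := fun s => by simp [flux, radialMean]
    simp [this, D.H_nonpos 0 le_rfl]

theorem delayIter_of_nonpos (D : RadialData b f H) (ε : ℝ) (j : ℕ) (α : ℝ) {r : ℝ} (hr : r ≤ 0) :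
    delayIter d b f H ε j α r = α := by
  cases j with
  | zero => rfl
  | succ j =>
    rw [delayIter, intervalIntegral.integral_symm,
      intervalIntegral.integral_congr (g := fun _ => 0), intervalIntegral.integral_zero]
    · simp
    · intro s hs
      rw [uIcc_of_le hr] at hs
      exact D.slope_eq_zero (fun t => delayIter d b f H ε j α (t - ε)) hs.2

theorem delayIter_succ_eq (D : RadialData b f H) (ε : ℝ) (j : ℕ) (α : ℝ) {r : ℝ}
    (hr : r ≤ j * ε) : delayIter d b f H ε (j + 1) α r = delayIter d b f H ε j α r := by
  induction j generalizing r with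
  | zero =>
    have hr0 : r ≤ 0 := by simpa using hr
    rw [D.delayIter_of_nonpos ε _ α hr0, D.delayIter_of_nonpos ε _ α hr0]
  | succ j ih =>
    rcases le_total r 0 with hr0 | hr0
    · rw [D.delayIter_of_nonpos ε _ α hr0, D.delayIter_of_nonpos ε _ α hr0]
    rw [delayIter, delayIter]
    congr 1
    refine intervalIntegral.integral_congr fun s hs => ?_
    rw [uIcc_of_le hr0] at hs
    push_cast at hr
    have := flux_congr d (k := fun t => b t * f (delayIter d b f H ε (j + 1) α (t - ε)))
      (k' := fun t => b t * f (delayIter d b f H ε j α (t - ε))) hr0 hs.2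
      fun t ht => by rw [ih (by linarith)]
    simp only [this]

/-- The delayed problem can be solved with any prescribed value at `R`. -/
theorem exists_delay_sol (D : RadialData b f H) (d : ℕ) {R : ℝ} (hR : 0 < R) {ε : ℝ} (hε : 0 < ε)
    {V : ℝ} (hV : 0 ≤ V) :
    ∃ w : ℝ → ℝ, Continuous w ∧ IsRadialSol d b f H R (fun t => w (t - ε)) w ∧ 0 ≤ w 0 ∧
      w R = V := by
  obtain ⟨j, hj⟩ := exists_nat_ge (R / ε)
  rw [div_le_iff₀ hε] at hj
  have hsol : ∀ α, IsRadialSol d b f H R (fun t => delayIter d b f H ε j α (t - ε))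
      (delayIter d b f H ε j α) := by
    intro α r hr
    rw [← D.delayIter_succ_eq ε j α (hr.trans hj), D.delayIter_of_nonpos ε j α le_rfl, delayIter]
  have hcont := D.continuous_delayIter (d := d) ε j
  have hcw : ∀ α, Continuous (delayIter d b f H ε j α) := fun α =>
    hcont.comp (by fun_prop : Continuous fun r : ℝ => (α, r))
  have hcR : Continuous fun α => delayIter d b f H ε j α R :=
    hcont.comp (by fun_prop : Continuous fun α : ℝ => (α, R))
  have hVR : V ≤ delayIter d b f H ε j V R := by
    have := D.mono_of_sol (z := fun t => delayIter d b f H ε j V (t - ε))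
      ((hcw V).comp (continuous_id.sub continuous_const)) (hsol V) hR.le le_rfl
    rwa [D.delayIter_of_nonpos ε j V le_rfl] at this
  obtain ⟨α, hα, hαR⟩ := intermediate_value_Icc hV hcR.continuousOn
    (show V ∈ Icc _ _ from ⟨by simpa only [D.delayIter_zero] using hV, hVR⟩)
  refine ⟨_, hcw α, hsol α, ?_, hαR⟩
  rw [D.delayIter_of_nonpos ε j α le_rfl]
  exact hα.1

end RadialData

/-- Pointwise bounded equicontinuous sequences have pointwise convergent subsequences. -/
theorem exists_subseq_tendsto_of_equicontinuous {X : Type*} [TopologicalSpace X]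
    [TopologicalSpace.SeparableSpace X] (F : ℕ → X → ℝ) (hF : Equicontinuous F)
    (hb : ∀ x, ∃ B, ∀ n, |F n x| ≤ B) :
    ∃ (σ : ℕ → ℕ) (g : X → ℝ), StrictMono σ ∧
      ∀ x, Tendsto (fun n => F (σ n) x) atTop (nhds (g x)) := by
  rcases isEmpty_or_nonempty X with hX | hX
  · exact ⟨id, fun _ => 0, strictMono_id, fun x => (hX.false x).elim⟩
  choose B hB using hb
  let q := TopologicalSpace.denseSeq X
  have hcomp : IsCompact (Set.pi univ fun i : ℕ => Icc (-B (q i)) (B (q i))) :=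
    isCompact_univ_pi fun _ => isCompact_Icc
  obtain ⟨g, -, σ, hσ, hg⟩ := hcomp.tendsto_subseq (x := fun n i => F n (q i))
    fun n i _ => abs_le.mp (hB _ _)
  rw [tendsto_pi_nhds] at hg
  have hcau : ∀ x, CauchySeq fun n => F (σ n) x := by
    intro x
    rw [Metric.cauchySeq_iff']
    intro ε hε
    obtain ⟨U, hU, hUF⟩ := Metric.equicontinuousAt_iff_pair.mp (hF x) (ε / 3) (by positivity)
    obtain ⟨_, ⟨i, rfl⟩, hyU⟩ := (TopologicalSpace.denseRange_denseSeq X).inter_nhds_nonempty hU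
    have hxU := mem_of_mem_nhds hU
    obtain ⟨n₀, hn₀⟩ := Metric.cauchySeq_iff'.mp (hg i).cauchySeq (ε / 3) (by positivity)
    refine ⟨n₀, fun n hn => ?_⟩
    have h1 := hUF x hxU _ hyU (σ n)
    have h2 := hUF _ hyU x hxU (σ n₀)
    have h3 := hn₀ n hn
    simp only [Function.comp] at h3
    have t1 := dist_triangle (F (σ n) x) (F (σ n) (q i)) (F (σ n₀) x)
    have t2 := dist_triangle (F (σ n) (q i)) (F (σ n₀) (q i)) (F (σ n₀) x)
    linarith
  choose g' hg' using fun x => cauchySeq_tendsto_of_complete (hcau x)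
  exact ⟨σ, g', hσ, hg'⟩

namespace RadialData

variable {d : ℕ} {b f H : ℝ → ℝ}

/-- Bounded pointwise limits of solutions are solutions. -/
theorem sol_of_tendsto (D : RadialData b f H) {A M B T R : ℝ} (hTR : T ≤ R) (hT : 0 ≤ T)
    (hA : ∀ t, b t ≤ A) (hM : ∀ t ∈ Icc 0 B, f t ≤ M) {z w : ℕ → ℝ → ℝ} {v : ℝ → ℝ}
    (hz : ∀ n, Continuous (z n)) (hzB : ∀ n, ∀ t ≤ T, z n t ∈ Icc 0 B)
    (hsol : ∀ n, IsRadialSol d b f H T (z n) (w n))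
    (hzv : ∀ t ≤ T, Tendsto (fun n => z n t) atTop (nhds (v t)))
    (hwv : ∀ t ≤ T, Tendsto (fun n => w n t) atTop (nhds (v t))) :
    IsRadialSol d b f H T v v := by
  intro r hr
  have hA0 : 0 ≤ A := (D.b_nonneg 0).trans (hA 0)
  have key : ∀ s ≤ T, Tendsto (fun n => flux d (fun t => b t * f (z n t)) s) atTop
      (nhds (flux d (fun t => b t * f (v t)) s)) := by
    intro s hs
    refine tendsto_const_nhds.mul ?_
    have hst : ∀ θ ∈ Ioc (0:ℝ) 1, s * θ ≤ T := fun θ hθ => by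
      rcases le_total s 0 with h0 | h0
      · nlinarith [hθ.1]
      · nlinarith [hθ.2]
    refine intervalIntegral.tendsto_integral_filter_of_dominated_convergence (fun _ => A * M)
      (.of_forall fun n => ?_) (.of_forall fun n => .of_forall fun θ hθ => ?_) (by simp)
      (.of_forall fun θ hθ => ?_)
    · have := D.b_cont; have := D.f_cont; have := hz n
      exact Continuous.aestronglyMeasurable (by fun_prop)
    · rw [uIoc_of_le zero_le_one] at hθ
      rw [Real.norm_of_nonneg (mul_nonneg (pow_nonneg hθ.1.le _) (D.source_nonneg (z n) _))]
      have h1 : θ ^ d ≤ 1 := pow_le_one₀ hθ.1.le hθ.2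
      have h2 : b (s * θ) * f (z n (s * θ)) ≤ A * M :=
        mul_le_mul (hA _) (hM _ (hzB n _ (hst θ hθ))) (D.f_nonneg _) hA0
      calc _ ≤ 1 * (b (s * θ) * f (z n (s * θ))) :=
            mul_le_mul_of_nonneg_right h1 (D.source_nonneg (z n) _)
        _ ≤ A * M := by linarith
    · rw [uIoc_of_le zero_le_one] at hθ
      exact tendsto_const_nhds.mul (tendsto_const_nhds.mul
        ((D.f_cont.tendsto _).comp (hzv _ (hst θ hθ))))
  have hlim : Tendsto (fun n => w n 0 + ∫ s in (0:ℝ)..r, H (flux d (fun t => b t * f (z n t)) s))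
      atTop (nhds (v 0 + ∫ s in (0:ℝ)..r, H (flux d (fun t => b t * f (v t)) s))) := by
    refine (hwv 0 hT).add ?_
    have hsT : ∀ s ∈ uIoc 0 r, s ≤ T := fun s hs => by
      rw [uIoc, mem_Ioc] at hs; exact hs.2.trans (max_le hT hr)
    refine intervalIntegral.tendsto_integral_filter_of_dominated_convergence
      (fun _ => H (R * (A * M)))
      (.of_forall fun n => (D.continuous_slope (hz n)).aestronglyMeasurable)
      (.of_forall fun n => .of_forall fun s hs => ?_) (by simp) (.of_forall fun s hs => ?_)
    · rw [Real.norm_of_nonneg (D.H_nonneg _)]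
      exact D.slope_le (hz n) hTR hA hM (fun t ht => hzB n t ht.2) (hsT s hs)
    · exact (D.H_cont.tendsto _).comp (key s (hsT s hs))
  refine tendsto_nhds_unique (hwv r hr) (hlim.congr fun n => ?_)
  exact (hsol n r hr).symm

end RadialData
theorem exists_subseq_tendsto_of_locally_lipschitz {S : Set ℝ} (w : ℕ → ℝ → ℝ)
    (hb : ∀ x ∈ S, ∃ B, ∀ n, |w n x| ≤ B)
    (hL : ∀ x ∈ S, ∃ L, ∃ U ∈ nhds x, ∀ n, ∀ y ∈ U ∩ S, |w n y - w n x| ≤ L * |y - x|) :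
    ∃ (σ : ℕ → ℕ) (g : ℝ → ℝ), StrictMono σ ∧
      ∀ x ∈ S, Tendsto (fun n => w (σ n) x) atTop (nhds (g x)) := by
  obtain ⟨σ, g, hσ, hg⟩ := exists_subseq_tendsto_of_equicontinuous
    (fun n (x : S) => w n x) (fun x => by
      obtain ⟨L, U, hU, h⟩ := hL x x.2
      refine Metric.equicontinuousAt_of_continuity_modulus (fun y : S => L * |(y:ℝ) - x|) ?_ _ ?_
      · have : Continuous fun y : S => L * |(y:ℝ) - x| := by fun_prop
        simpa using this.tendsto x
      · filter_upwards [continuous_subtype_val.continuousAt.preimage_mem_nhds hU] with y hy n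
        rw [dist_comm, Real.dist_eq]
        exact h n y ⟨hy, y.2⟩) (fun x => hb x x.2)
  classical
  refine ⟨σ, fun x => if hx : x ∈ S then g ⟨x, hx⟩ else 0, hσ, fun x hx => ?_⟩
  simpa [hx] using hg ⟨x, hx⟩

namespace RadialData

variable {d : ℕ} {b f H : ℝ → ℝ}

theorem exists_bound_on_Icc (D : RadialData b f H) (B : ℝ) :
    ∃ M, 0 ≤ M ∧ ∀ t ∈ Icc 0 B, f t ≤ M := by
  obtain ⟨M, hM⟩ := (isCompact_Icc (a := (0:ℝ)) (b := B)).exists_bound_of_continuousOn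
    D.f_cont.continuousOn
  exact ⟨max M 0, le_max_right _ _,
    fun t ht => ((le_abs_self _).trans (hM t ht)).trans (le_max_left _ _)⟩

theorem nonneg_of_sol (D : RadialData b f H) {T : ℝ} {z w : ℝ → ℝ}
    (hz : Continuous z) (hw : IsRadialSol d b f H T z w) (h0 : 0 ≤ w 0) {x : ℝ} (hx : x ≤ T) :
    0 ≤ w x := by
  rcases le_total x 0 with h | h
  · rwa [D.const_of_sol hw h hx]
  · exact h0.trans (D.mono_of_sol hz hw h hx)

theorem sol_congr {T : ℝ} (hT : 0 ≤ T) {z z' w w' : ℝ → ℝ}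
    (hz : ∀ t ≤ T, z t = z' t) (hw : ∀ t ≤ T, w t = w' t) (h : IsRadialSol d b f H T z w) :
    IsRadialSol d b f H T z' w' := by
  intro r hr
  rw [← hw r hr, ← hw 0 hT, h r hr]
  congr 1
  refine intervalIntegral.integral_congr fun s hs => ?_
  have hsT : s ≤ T := hs.2.trans (max_le hT hr)
  have := flux_congr d (k := fun t => b t * f (z t)) (k' := fun t => b t * f (z' t)) hT hsT
    fun t ht => by rw [hz t ht]
  simp only [this]

/-- The radial problem can be solved with any prescribed value at `R`. -/
theorem exists_sol (D : RadialData b f H) (d : ℕ) {R : ℝ} (hR : 0 < R) {A : ℝ}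
    (hA : ∀ t, b t ≤ A) {V : ℝ} (hV : 0 ≤ V) :
    ∃ w : ℝ → ℝ, Continuous w ∧ IsRadialSol d b f H R w w ∧ 0 ≤ w 0 ∧ w R = V := by
  choose w hwc hws hw0 hwR using fun k : ℕ =>
    D.exists_delay_sol d hR (ε := 1 / ((k:ℝ) + 1)) (by positivity) hV
  obtain ⟨M, -, hM⟩ := D.exists_bound_on_Icc V
  set e : ℕ → ℝ := fun k => 1 / ((k:ℝ) + 1) with he
  have he0 : ∀ k, 0 < e k := fun k => by simp only [he]; positivity
  have hzc : ∀ k, Continuous fun t => w k (t - e k) := fun k =>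
    (hwc k).comp (continuous_id.sub continuous_const)
  have hwV : ∀ k, ∀ t ≤ R, w k t ∈ Icc 0 V := fun k t ht =>
    ⟨D.nonneg_of_sol (hzc k) (hws k) (hw0 k) ht,
      (D.mono_of_sol (hzc k) (hws k) ht le_rfl).trans (hwR k).le⟩
  have hzV : ∀ k, ∀ t ≤ R, w k (t - e k) ∈ Icc 0 V := fun k t ht =>
    hwV k _ (by linarith [he0 k])
  have hlip : ∀ k, ∀ x ≤ R, ∀ y ≤ R, |w k y - w k x| ≤ H (R * (A * M)) * |y - x| :=
    fun k x hx y hy =>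
      D.lipschitz_of_sol (hzc k) le_rfl hA hM (fun t ht => hzV k t ht.2) (hws k) hx hy
  obtain ⟨σ, g, hσ, hg⟩ := exists_subseq_tendsto_of_locally_lipschitz (S := Iic R) w
    (fun x hx => ⟨V, fun n => by rw [abs_of_nonneg (hwV n x hx).1]; exact (hwV n x hx).2⟩)
    (fun x hx => ⟨_, univ, univ_mem, fun n y hy => hlip n x hx y hy.2⟩)
  have hglip : ∀ x ≤ R, ∀ y ≤ R, |g y - g x| ≤ H (R * (A * M)) * |y - x| := fun x hx y hy =>
    le_of_tendsto ((hg y hy).sub (hg x hx)).abs (.of_forall fun n => hlip _ x hx y hy)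
  have hgc : ContinuousOn g (Iic R) := by
    have : LipschitzOnWith (Real.toNNReal (H (R * (A * M)))) g (Iic R) :=
      LipschitzOnWith.of_dist_le_mul fun x hx y hy => by
        rw [Real.coe_toNNReal _ (D.H_nonneg _), Real.dist_eq, Real.dist_eq]
        exact hglip y hy x hx
    exact this.continuousOn
  have hesub : Tendsto (fun n => e (σ n)) atTop (nhds 0) :=
    tendsto_one_div_add_atTop_nhds_zero_nat.comp hσ.tendsto_atTop
  have hgz : ∀ t ≤ R, Tendsto (fun n => w (σ n) (t - e (σ n))) atTop (nhds (g t)) := by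
    intro t ht
    have h1 : Tendsto (fun n => w (σ n) (t - e (σ n)) - w (σ n) t) atTop (nhds 0) := by
      refine squeeze_zero_norm (a := fun n => H (R * (A * M)) * e (σ n)) (fun n => ?_)
        (by simpa using hesub.const_mul (H (R * (A * M))))
      have := hlip (σ n) t ht (t - e (σ n)) (by linarith [he0 (σ n)])
      rwa [sub_sub_cancel_left, abs_neg, abs_of_pos (he0 _)] at this
    simpa using h1.add (hg t ht)
  have hgs : IsRadialSol d b f H R g g :=
    D.sol_of_tendsto le_rfl hR.le hA hM (fun n => hzc (σ n)) (fun n => hzV (σ n))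
      (fun n => hws (σ n)) hgz hg
  have heq : ∀ t ≤ R, g t = g (min t R) := fun t ht => by rw [min_eq_left ht]
  refine ⟨fun t => g (min t R), ?_, sol_congr hR.le heq heq hgs, ?_, ?_⟩
  · exact hgc.comp_continuous (by fun_prop) fun t => mem_Iic.mpr (min_le_right _ _)
  · simp only [min_eq_left hR.le]
    exact ge_of_tendsto (hg 0 hR.le) (.of_forall fun n => hw0 _)
  · simp only [min_self]
    exact tendsto_nhds_unique (hg R self_mem_Iic) (by simp [hwR])

end RadialData

/-- The Keller–Osserman growth assumptions: `h` is inverted by `H` on `[0, ∞)`, `f` is almost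
increasing beyond `v₀`, and `1 / G` is integrable at infinity, where `G` stands for `Φ⁻¹ ∘ F`. -/
structure KellerOsserman (f h H G : ℝ → ℝ) (c C v₀ : ℝ) : Prop where
  h_mono : Monotone h
  h_H : ∀ y, 0 ≤ y → h (H y) = y
  c_pos : 0 < c
  C_pos : 0 < C
  two_le : 2 ≤ v₀
  f_pos : ∀ v, v₀ ≤ v → 0 < f v
  f_almost_mono : ∀ s t, v₀ ≤ s → s ≤ t → c * f s ≤ f t
  G_pos : ∀ t, 1 ≤ t → 0 < G t
  G_mono : MonotoneOn G (Ici 1)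
  h_G_le : ∀ v, v₀ ≤ v → h (G v) * G v ≤ C * (v * f v)
  integrable : IntegrableOn (fun t => 1 / G t) (Ioi 1)

namespace KellerOsserman

variable {d : ℕ} {b f h H G : ℝ → ℝ} {c C v₀ : ℝ}

theorem intervalIntegrable (K : KellerOsserman f h H G c C v₀) {x y : ℝ} (hx : 1 ≤ x)
    (hy : 1 ≤ y) : IntervalIntegrable (fun t => 1 / G t) volume x y := by
  rw [intervalIntegrable_iff]
  refine K.integrable.mono_set fun t ht => ?_
  rw [uIoc, mem_Ioc] at ht
  exact lt_of_le_of_lt (le_min hx hy) ht.1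

theorem half_div_le (K : KellerOsserman f h H G c C v₀) {v : ℝ} (hv : v₀ ≤ v) :
    v / 2 / G v ≤ (∫ t in (1:ℝ)..v, 1 / G t) - ∫ t in (1:ℝ)..(v / 2), 1 / G t := by
  have h2 := K.two_le
  rw [intervalIntegral.integral_interval_sub_left (K.intervalIntegrable le_rfl (by linarith))
    (K.intervalIntegrable le_rfl (by linarith))]
  have : ∫ _t in (v / 2)..v, 1 / G v ≤ ∫ t in (v / 2)..v, 1 / G t := by
    refine intervalIntegral.integral_mono_on (by linarith) (by simp)
      (K.intervalIntegrable (by linarith) (by linarith)) fun t ht => ?_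
    have ht1 : 1 ≤ t := by linarith [ht.1]
    exact one_div_le_one_div_of_le (K.G_pos t ht1)
      (K.G_mono ht1 (show (1:ℝ) ≤ v by linarith) ht.2)
  rw [intervalIntegral.integral_const, smul_eq_mul] at this
  convert this using 1
  ring

theorem integral_mono (K : KellerOsserman f h H G c C v₀) {x y : ℝ} (hx : 1 ≤ x) (hxy : x ≤ y) :
    ∫ t in (1:ℝ)..x, 1 / G t ≤ ∫ t in (1:ℝ)..y, 1 / G t := by
  have := intervalIntegral.integral_interval_sub_left
    (K.intervalIntegrable le_rfl (hx.trans hxy)) (K.intervalIntegrable le_rfl hx)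
  have h0 : 0 ≤ ∫ t in x..y, 1 / G t := intervalIntegral.integral_nonneg hxy fun t ht =>
    (one_div_pos.mpr (K.G_pos t (hx.trans ht.1))).le
  linarith

theorem tendsto_integral (K : KellerOsserman f h H G c C v₀) :
    Tendsto (fun x => ∫ t in (1:ℝ)..x, 1 / G t) atTop (nhds (∫ t in Ioi (1:ℝ), 1 / G t)) :=
  intervalIntegral_tendsto_integral_Ioi 1 K.integrable tendsto_id

theorem integral_le (K : KellerOsserman f h H G c C v₀) {x : ℝ} (hx : 1 ≤ x) :
    ∫ t in (1:ℝ)..x, 1 / G t ≤ ∫ t in Ioi (1:ℝ), 1 / G t :=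
  ge_of_tendsto K.tendsto_integral
    ((eventually_ge_atTop x).mono fun _ hy => K.integral_mono hx hy)

/-- The time a solution needs to double its value. -/
theorem doubling_time (K : KellerOsserman f h H G c C v₀) (D : RadialData b f H)
    {b₀ r₀ R κ : ℝ} (hb₀ : 0 < b₀) (hb : ∀ t, b₀ ≤ b t) (hr₀ : 0 < r₀) (hr₀R : r₀ < R)
    (hκ2 : 2 ≤ κ) (hκ : 2 * C ≤ κ * ((r₀ / R) ^ d * (b₀ * c)))
    {w : ℝ → ℝ} (hwc : Continuous w) (hw : IsRadialSol d b f H R w w) {r₁ r₂ : ℝ}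
    (h01 : r₀ ≤ r₁) (h2R : r₂ ≤ R) (hv : v₀ ≤ w r₁) (hdbl : w r₂ ≤ 2 * w r₁) :
    r₂ - r₁ ≤ 2 * κ * ((∫ t in (1:ℝ)..(w r₁), 1 / G t) - ∫ t in (1:ℝ)..(w r₁ / 2), 1 / G t) := by
  set v := w r₁ with hvdef
  have h2 := K.two_le
  have hv0 : 0 < v := by linarith
  have hfv : 0 < f v := K.f_pos v hv
  have hz : 0 < G v := K.G_pos v (by linarith)
  have hR : 0 < R := hr₀.trans hr₀R
  set q := (r₀ / R) ^ d * (b₀ * c) with hq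
  have hqpos : 0 < q := by have := K.c_pos; positivity
  suffices hδ : (r₂ - r₁) * G v ≤ κ * v by
    have h3 := K.half_div_le hv
    have h4 : r₂ - r₁ ≤ κ * v / G v := by rwa [le_div_iff₀ hz]
    have h5 : κ * v / G v = 2 * κ * (v / 2 / G v) := by ring
    rw [h5] at h4
    exact h4.trans (mul_le_mul_of_nonneg_left h3 (by linarith))
  by_contra! hcon
  set δ := r₂ - r₁ with hδdef
  have hδ0 : 0 < δ := by
    by_contra! hle
    nlinarith
  have hflux : ∀ s ∈ Icc r₁ r₂, q * f v * (s - r₁) ≤ flux d (fun t => b t * f (w t)) s := by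
    intro s hs
    have := le_flux d (D.b_cont.mul (D.f_cont.comp hwc)) (D.source_nonneg w) hr₀ h01 hs.1
      (hs.2.trans h2R) (κ := b₀ * (c * f v)) (by have := K.c_pos; positivity)
      fun t ht => mul_le_mul (hb t)
        (K.f_almost_mono v (w t) hv
          (D.mono_of_sol hwc hw ht.1 (ht.2.trans (hs.2.trans h2R))))
        (by have := K.c_pos; positivity) (hb₀.le.trans (hb t))
    calc q * f v * (s - r₁) = (r₀ / R) ^ d * (b₀ * (c * f v)) * (s - r₁) := by rw [hq]; ring
      _ ≤ _ := this
  set Y := q * f v * (δ / 2) with hY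
  have hYpos : 0 < Y := by positivity
  have hmid : r₁ + δ / 2 ≤ r₂ := by rw [hδdef]; linarith
  have hgrow : δ / 2 * H Y ≤ v := by
    have h3 : ∫ _s in (r₁ + δ / 2)..r₂, H Y ≤
        ∫ s in (r₁ + δ / 2)..r₂, H (flux d (fun t => b t * f (w t)) s) := by
      refine intervalIntegral.integral_mono_on hmid (by simp)
        ((D.continuous_slope hwc).intervalIntegrable _ _) fun s hs => D.H_mono ?_
      refine le_trans ?_ (hflux s ⟨by linarith [hs.1], hs.2⟩)
      rw [hY]
      exact mul_le_mul_of_nonneg_left (by linarith [hs.1]) (by positivity)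
    rw [← D.sub_eq_integral hwc hw (hmid.trans h2R) h2R, intervalIntegral.integral_const,
      smul_eq_mul] at h3
    have h4 : w r₁ ≤ w (r₁ + δ / 2) :=
      D.mono_of_sol hwc hw (by linarith) (hmid.trans h2R)
    have h5 : r₂ - (r₁ + δ / 2) = δ / 2 := by rw [hδdef]; ring
    rw [h5] at h3
    linarith
  have hlt : H Y < G v := by
    have : δ * H Y < δ * G v := by nlinarith
    exact lt_of_mul_lt_mul_left this hδ0.le
  have hle : Y ≤ h (G v) := by
    have := K.h_mono hlt.le
    rwa [K.h_H Y hYpos.le] at this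
  have h6 := K.h_G_le v hv
  have h7 : Y * G v ≤ C * (v * f v) := (mul_le_mul_of_nonneg_right hle hz.le).trans h6
  have h8 : q * f v * (κ * v) < q * f v * (δ * G v) :=
    mul_lt_mul_of_pos_left hcon (by positivity)
  have h9 : 2 * C * (v * f v) ≤ κ * q * (v * f v) :=
    mul_le_mul_of_nonneg_right hκ (by positivity)
  rw [hY] at h7
  nlinarith

theorem remaining_time (K : KellerOsserman f h H G c C v₀) (D : RadialData b f H)
    {b₀ r₀ R κ : ℝ} (hb₀ : 0 < b₀) (hb : ∀ t, b₀ ≤ b t) (hr₀ : 0 < r₀) (hr₀R : r₀ < R)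
    (hκ2 : 2 ≤ κ) (hκ : 2 * C ≤ κ * ((r₀ / R) ^ d * (b₀ * c)))
    {w : ℝ → ℝ} (hwc : Continuous w) (hw : IsRadialSol d b f H R w w) (j : ℕ) {r₁ : ℝ}
    (h01 : r₀ ≤ r₁) (h1R : r₁ ≤ R) (hv : v₀ ≤ w r₁) (hj : w R < 2 ^ j * w r₁) :
    R - r₁ ≤ 2 * κ * ((∫ t in Ioi (1:ℝ), 1 / G t) - ∫ t in (1:ℝ)..(w r₁ / 2), 1 / G t) := by
  have h2 := K.two_le
  induction j generalizing r₁ with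
  | zero =>
    have := D.mono_of_sol hwc hw h1R le_rfl
    simp only [pow_zero, one_mul] at hj
    linarith
  | succ j ih =>
    have hstep := fun r₂ => K.doubling_time D hb₀ hb hr₀ hr₀R hκ2 hκ hwc hw (r₂ := r₂) h01
    have hJ := K.integral_le (x := w r₁) (by linarith)
    rcases le_total (w R) (2 * w r₁) with hle | hge
    · refine (hstep R le_rfl hv hle).trans ?_
      exact mul_le_mul_of_nonneg_left (by linarith) (by linarith)
    · obtain ⟨r₂, hr₂, hwr₂⟩ := intermediate_value_Icc h1R hwc.continuousOn
        (show 2 * w r₁ ∈ Icc (w r₁) (w R) from ⟨by linarith, hge⟩)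
      have e1 := hstep r₂ hr₂.2 hv hwr₂.le
      have e2 := ih (h01.trans hr₂.1) hr₂.2 (by rw [hwr₂]; linarith)
        (by rw [hwr₂]; rw [pow_succ] at hj; linarith)
      rw [hwr₂, mul_div_cancel_left₀ _ (two_ne_zero)] at e2
      linarith

/-- Interior bound for solutions, uniform in their boundary value. -/
theorem interior_bound (K : KellerOsserman f h H G c C v₀) (D : RadialData b f H) (d : ℕ)
    {b₀ r₀ R : ℝ} (hb₀ : 0 < b₀) (hb : ∀ t, b₀ ≤ b t) (hr₀ : 0 < r₀) (hr₀R : r₀ < R) :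
    ∃ B, ∀ w : ℝ → ℝ, Continuous w → IsRadialSol d b f H R w w → w r₀ ≤ B := by
  have hR : 0 < R := hr₀.trans hr₀R
  have h2 := K.two_le
  set q := (r₀ / R) ^ d * (b₀ * c) with hq
  have hqpos : 0 < q := by have := K.c_pos; positivity
  set κ := max 2 (2 * C / q) with hκdef
  have hκ2 : 2 ≤ κ := le_max_left _ _
  have hκ : 2 * C ≤ κ * q := by
    rw [← div_le_iff₀ hqpos]; exact le_max_right _ _
  have hlim : Tendsto (fun x => 2 * κ * ((∫ t in Ioi (1:ℝ), 1 / G t) - ∫ t in (1:ℝ)..x, 1 / G t))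
      atTop (nhds 0) := by
    simpa using (K.tendsto_integral.const_sub (∫ t in Ioi (1:ℝ), 1 / G t)).const_mul (2 * κ)
  obtain ⟨x₀, hx₀, hx₀v⟩ := ((hlim.eventually_lt_const (sub_pos.mpr hr₀R)).and
    (eventually_ge_atTop v₀)).exists
  refine ⟨2 * x₀, fun w hwc hw => ?_⟩
  by_contra! hcon
  obtain ⟨j, hj⟩ := pow_unbounded_of_one_lt (w R) (one_lt_two (α := ℝ))
  have hj' : w R < 2 ^ j * w r₀ := by
    have : (0:ℝ) < 2 ^ j := by positivity
    nlinarith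
  have := K.remaining_time D hb₀ hb hr₀ hr₀R hκ2 hκ hwc hw j le_rfl hr₀R.le
    (by linarith) hj'
  have hm := K.integral_mono (x := x₀) (y := w r₀ / 2) (by linarith) (by linarith)
  have hm' := mul_le_mul_of_nonneg_left hm (show 0 ≤ 2 * κ by linarith)
  linarith

end KellerOsserman

variable {b f h H G : ℝ → ℝ} {c C v₀ : ℝ}

theorem RadialData.lower_bound_near_boundary (D : RadialData b f H) (d : ℕ) {R A : ℝ}
    (hA : ∀ t, b t ≤ A) (M : ℝ) :
    ∃ δ > 0, ∀ w : ℝ → ℝ, Continuous w → IsRadialSol d b f H R w w → 0 ≤ w 0 →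
      M + 1 ≤ w R → ∀ r ≤ R, R - δ < r → M ≤ w r := by
  obtain ⟨M₁, -, hM₁⟩ := D.exists_bound_on_Icc (M + 1)
  have hL := D.H_nonneg (R * (A * M₁))
  refine ⟨1 / (H (R * (A * M₁)) + 1), by positivity, fun w hwc hw hw0 hwR r hr hδ => ?_⟩
  by_contra! hcon
  obtain ⟨r', hr', hwr'⟩ := intermediate_value_Icc hr hwc.continuousOn
    (show M + 1 ∈ Icc (w r) (w R) from ⟨by linarith, hwR⟩)
  have hlip := D.lipschitz_of_sol hwc hr'.2 hA hM₁ (T := r') (x := r) (y := r')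
    (fun t ht => ⟨D.nonneg_of_sol hwc hw hw0 (ht.2.trans hr'.2),
      (D.mono_of_sol hwc hw ht.2 hr'.2).trans hwr'.le⟩)
    (fun s hs => hw s (hs.trans hr'.2)) hr'.1 le_rfl
  rw [abs_of_nonneg (sub_nonneg.mpr hr'.1)] at hlip
  have h1 := le_abs_self (w r' - w r)
  have hrr := hr'.1
  have h2 : (r' - r) * (H (R * (A * M₁)) + 1) < 1 := by
    rw [← lt_div_iff₀ (by positivity)]; linarith [hr'.2]
  nlinarith [hrr]

/-- Existence of a solution of the radial problem on `(-∞, R)` blowing up at `R`. -/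
theorem KellerOsserman.exists_blowup (K : KellerOsserman f h H G c C v₀) (D : RadialData b f H)
    (d : ℕ) {b₀ A R : ℝ} (hb₀ : 0 < b₀) (hb : ∀ t, b₀ ≤ b t) (hA : ∀ t, b t ≤ A) (hR : 0 < R) :
    ∃ w : ℝ → ℝ, ContinuousOn w (Iio R) ∧ (∀ r < R, 0 ≤ w r) ∧
      (∀ T < R, IsRadialSol d b f H T w w) ∧
      ∀ M, ∃ δ > 0, ∀ r < R, R - δ < r → M < w r := by
  choose w hwc hws hw0 hwR using fun n : ℕ => D.exists_sol d hR hA (Nat.cast_nonneg (α := ℝ) n)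
  have hnn : ∀ n, ∀ x ≤ R, 0 ≤ w n x := fun n x hx =>
    D.nonneg_of_sol (hwc n) (hws n) (hw0 n) hx
  have hbd : ∀ T < R, ∃ B, ∀ n, ∀ t ≤ T, w n t ∈ Icc 0 B := by
    intro T hT
    obtain ⟨B, hB⟩ := K.interior_bound D d hb₀ hb (r₀ := max T (R / 2)) (R := R)
      (lt_of_lt_of_le (by linarith) (le_max_right _ _)) (max_lt hT (by linarith))
    refine ⟨B, fun n t ht => ⟨hnn n t (ht.trans hT.le), ?_⟩⟩
    exact (D.mono_of_sol (hwc n) (hws n) (ht.trans (le_max_left _ _))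
      (max_lt hT (by linarith)).le).trans (hB _ (hwc n) (hws n))
  have hlip : ∀ T < R, ∃ L, 0 ≤ L ∧ ∀ n, ∀ x ≤ T, ∀ y ≤ T, |w n y - w n x| ≤ L * |y - x| := by
    intro T hT
    obtain ⟨B, hB⟩ := hbd T hT
    obtain ⟨M, -, hM⟩ := D.exists_bound_on_Icc B
    refine ⟨H (R * (A * M)), D.H_nonneg _, fun n x hx y hy => ?_⟩
    exact D.lipschitz_of_sol (hwc n) hT.le hA hM (fun t ht => hB n t ht.2)
      (fun s hs => hws n s (hs.trans hT.le)) hx hy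
  obtain ⟨σ, g, hσ, hg⟩ := exists_subseq_tendsto_of_locally_lipschitz (S := Iio R) w
    (fun x hx => by
      obtain ⟨B, hB⟩ := hbd x hx
      exact ⟨B, fun n => by rw [abs_of_nonneg (hB n x le_rfl).1]; exact (hB n x le_rfl).2⟩)
    (fun x hx => by
      obtain ⟨T, hxT, hTR⟩ := exists_between (mem_Iio.mp hx)
      obtain ⟨L, -, hL⟩ := hlip T hTR
      exact ⟨L, Iic T, Iic_mem_nhds hxT, fun n y hy => hL n x hxT.le y hy.1⟩)
  refine ⟨g, ?_, ?_, ?_, ?_⟩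
  · intro x hx
    obtain ⟨T, hxT, hTR⟩ := exists_between (mem_Iio.mp hx)
    obtain ⟨L, hL0, hL⟩ := hlip T hTR
    have hg' : LipschitzOnWith (Real.toNNReal L) g (Iic T) :=
      LipschitzOnWith.of_dist_le_mul fun y hy z hz => by
        rw [Real.coe_toNNReal _ hL0, Real.dist_eq, Real.dist_eq]
        exact le_of_tendsto ((hg y (lt_of_le_of_lt hy hTR)).sub (hg z (lt_of_le_of_lt hz hTR))).abs
          (.of_forall fun n => hL _ z hz y hy)
    exact (hg'.continuousOn.continuousAt (Iic_mem_nhds hxT)).continuousWithinAt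
  · exact fun r hr => ge_of_tendsto (hg r hr) (.of_forall fun n => hnn _ r hr.le)
  · intro T hT
    obtain ⟨B, hB⟩ := hbd (max T 0) (max_lt hT hR)
    obtain ⟨M, -, hM⟩ := D.exists_bound_on_Icc B
    have hT' : max T 0 < R := max_lt hT hR
    have hsol : IsRadialSol d b f H (max T 0) g g :=
      D.sol_of_tendsto hT'.le (le_max_right _ _) hA hM (fun n => hwc (σ n)) (fun n => hB (σ n))
        (fun n s hs => hws (σ n) s (hs.trans hT'.le))
        (fun t ht => hg t (lt_of_le_of_lt ht hT')) (fun t ht => hg t (lt_of_le_of_lt ht hT'))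
    exact fun s hs => hsol s (hs.trans (le_max_left _ _))
  · intro M
    obtain ⟨δ, hδ, hlow⟩ := D.lower_bound_near_boundary d (R := R) hA (M + 1)
    refine ⟨δ, hδ, fun r hr hrδ => lt_of_lt_of_le (lt_add_one M) ?_⟩
    refine ge_of_tendsto (hg r hr) ?_
    filter_upwards [(tendsto_natCast_atTop_atTop (R := ℝ)).comp hσ.tendsto_atTop
      |>.eventually_ge_atTop (M + 1 + 1)] with n hn
    exact hlow _ (hwc _) (hws _) (hw0 _) (by rw [hwR]; exact hn) r hr.le hrδ

theorem RadialData.hasDerivAt_of_sol {d : ℕ} (D : RadialData b f H) {R : ℝ} (hR : 0 < R)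
    {w : ℝ → ℝ} (hwc : ContinuousOn w (Iio R)) (hw : ∀ T < R, IsRadialSol d b f H T w w)
    {r : ℝ} (hr : r < R) :
    HasDerivAt w (H (flux d (fun t => b t * f (w t)) r)) r ∧
      ContinuousAt (fun r => H (flux d (fun t => b t * f (w t)) r)) r := by
  obtain ⟨T, hT, hTR⟩ := exists_between (max_lt hr hR)
  have hT0 : 0 ≤ T := (le_max_right _ _).trans hT.le
  have hrT : r < T := (le_max_left _ _).trans_lt hT
  set z : ℝ → ℝ := fun t => w (min t T) with hz
  have hzc : Continuous z := hwc.comp_continuous (by fun_prop) fun t =>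
    lt_of_le_of_lt (min_le_right _ _) hTR
  have hzw : ∀ t ≤ T, w t = z t := fun t ht => by simp only [hz, min_eq_left ht]
  have hflux : ∀ s ≤ T, H (flux d (fun t => b t * f (w t)) s) =
      H (flux d (fun t => b t * f (z t)) s) := fun s hs => by
    rw [flux_congr d hT0 hs (k' := fun t => b t * f (z t)) fun t ht => by rw [hzw t ht]]
  have hzs : IsRadialSol d b f H T z w := sol_congr hT0 hzw (fun _ _ => rfl) (hw T hTR)
  have hslope := D.continuous_slope (d := d) hzc
  refine ⟨?_, ?_⟩
  · rw [hflux r hrT.le]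
    have h1 := (intervalIntegral.integral_hasDerivAt_right
      (hslope.intervalIntegrable 0 r) (hslope.stronglyMeasurableAtFilter _ _)
      hslope.continuousAt).const_add (w 0)
    refine h1.congr_of_eventuallyEq ?_
    filter_upwards [Iic_mem_nhds hrT] with s hs
    exact hzs s hs
  · refine hslope.continuousAt.congr ?_
    filter_upwards [Iic_mem_nhds hrT] with s hs
    exact (hflux s hs).symm

/-- `t ↦ φ(t)t` extended by the identity to the negative half-line. -/
noncomputable def slopeFlux (φ : ℝ → ℝ) (t : ℝ) : ℝ := if 0 < t then φ t * t else t

theorem slopeFlux_of_nonneg (φ : ℝ → ℝ) {t : ℝ} (ht : 0 ≤ t) : slopeFlux φ t = φ t * t := by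
  rcases ht.eq_or_lt with rfl | h
  · simp [slopeFlux]
  · simp [slopeFlux, h]

theorem slopeFlux_of_nonpos (φ : ℝ → ℝ) {t : ℝ} (ht : t ≤ 0) : slopeFlux φ t = t := by
  simp [slopeFlux, ht.not_gt]

section

variable {φ : ℝ → ℝ} {l₁ : ℝ}

theorem monotoneOn_mul_rpow (hφC1 : ContDiffOn ℝ 1 φ (Ioi 0)) (hφpos : ∀ t > (0:ℝ), 0 < φ t)
    (hφ3 : ∀ t > (0:ℝ), l₁ ≤ deriv (fun s => φ s * s) t * t / (φ t * t)) :
    MonotoneOn (fun t => φ t * t * t ^ (-l₁)) (Ioi 0) := by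
  have hd : ∀ t > (0:ℝ), DifferentiableAt ℝ (fun s => φ s * s) t := fun t ht =>
    (((hφC1.differentiableOn one_ne_zero).differentiableAt (Ioi_mem_nhds ht)).mul
      differentiableAt_id)
  have hder : ∀ t > (0:ℝ), HasDerivAt (fun t => φ t * t * t ^ (-l₁))
      (deriv (fun s => φ s * s) t * t ^ (-l₁) + φ t * t * (-l₁ * t ^ (-l₁ - 1))) t := fun t ht =>
    (hd t ht).hasDerivAt.mul (Real.hasDerivAt_rpow_const (Or.inl (ne_of_gt ht)))
  refine monotoneOn_of_deriv_nonneg (convex_Ioi 0)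
    (fun t ht => (hder t ht).continuousAt.continuousWithinAt) ?_ ?_
  · rw [interior_Ioi]
    exact fun t ht => (hder t ht).differentiableAt.differentiableWithinAt
  · rw [interior_Ioi]
    intro t ht
    have ht0 : 0 < t := ht
    rw [(hder t ht).deriv]
    have h1 := hφ3 t ht
    rw [le_div_iff₀ (mul_pos (hφpos t ht) ht0)] at h1
    have h2 : t ^ (-l₁) = t ^ (-l₁ - 1) * t := by
      rw [← Real.rpow_add_one ht0.ne']; congr 1; ring
    rw [h2]
    have h3 : 0 < t ^ (-l₁ - 1) := Real.rpow_pos_of_pos ht0 _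
    nlinarith

theorem mul_le_rpow (hφC1 : ContDiffOn ℝ 1 φ (Ioi 0)) (hφpos : ∀ t > (0:ℝ), 0 < φ t)
    (hφ3 : ∀ t > (0:ℝ), l₁ ≤ deriv (fun s => φ s * s) t * t / (φ t * t)) {t : ℝ} (ht : 0 < t)
    (ht1 : t ≤ 1) : φ t * t ≤ φ 1 * t ^ l₁ := by
  have := monotoneOn_mul_rpow hφC1 hφpos hφ3 ht (zero_lt_one' ℝ) ht1
  simp only [Real.one_rpow, mul_one, Real.rpow_neg ht.le] at this
  rwa [← div_eq_mul_inv, div_le_iff₀ (Real.rpow_pos_of_pos ht _)] at this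

theorem rpow_le_mul (hφC1 : ContDiffOn ℝ 1 φ (Ioi 0)) (hφpos : ∀ t > (0:ℝ), 0 < φ t)
    (hφ3 : ∀ t > (0:ℝ), l₁ ≤ deriv (fun s => φ s * s) t * t / (φ t * t)) {t : ℝ}
    (ht1 : 1 ≤ t) : φ 1 * t ^ l₁ ≤ φ t * t := by
  have ht : 0 < t := by linarith
  have := monotoneOn_mul_rpow hφC1 hφpos hφ3 (zero_lt_one' ℝ) ht ht1
  simp only [Real.one_rpow, mul_one, Real.rpow_neg ht.le] at this
  rwa [← div_eq_mul_inv, le_div_iff₀ (Real.rpow_pos_of_pos ht _)] at this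

theorem strictMono_slopeFlux (hφC1 : ContDiffOn ℝ 1 φ (Ioi 0)) (hφpos : ∀ t > (0:ℝ), 0 < φ t)
    (hφ1 : ∀ t > (0:ℝ), 0 < deriv (fun s => φ s * s) t) : StrictMono (slopeFlux φ) := by
  have h1 : StrictMonoOn (fun s => φ s * s) (Ioi 0) :=
    strictMonoOn_of_deriv_pos (convex_Ioi 0) (hφC1.continuousOn.mul continuousOn_id)
      (by rw [interior_Ioi]; exact hφ1)
  intro s t hst
  rcases le_or_gt s 0 with hs | hs
  · rw [slopeFlux_of_nonpos φ hs]
    rcases le_or_gt t 0 with ht | ht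
    · rwa [slopeFlux_of_nonpos φ ht]
    · rw [slopeFlux_of_nonneg φ ht.le]
      exact hs.trans_lt (mul_pos (hφpos t ht) ht)
  · rw [slopeFlux_of_nonneg φ hs.le, slopeFlux_of_nonneg φ (hs.trans hst).le]
    exact h1 hs (hs.trans hst) hst

theorem continuous_slopeFlux (hφC1 : ContDiffOn ℝ 1 φ (Ioi 0)) (hφpos : ∀ t > (0:ℝ), 0 < φ t)
    (hl₁ : 0 < l₁)
    (hφ3 : ∀ t > (0:ℝ), l₁ ≤ deriv (fun s => φ s * s) t * t / (φ t * t)) :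
    Continuous (slopeFlux φ) := by
  rw [continuous_iff_continuousAt]
  intro t
  rcases lt_trichotomy t 0 with ht | rfl | ht
  · refine continuousAt_id.congr ?_
    filter_upwards [Iio_mem_nhds ht] with s hs
    exact (slopeFlux_of_nonpos φ (le_of_lt hs)).symm
  · have h0 : slopeFlux φ 0 = 0 := slopeFlux_of_nonpos φ le_rfl
    rw [ContinuousAt, h0]
    have hlim : Tendsto (fun s : ℝ => |s| + φ 1 * |s| ^ l₁) (nhds 0) (nhds 0) := by
      have hc : Continuous fun s : ℝ => |s| + φ 1 * |s| ^ l₁ :=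
        continuous_abs.add (continuous_const.mul
          (continuous_abs.rpow_const fun s => Or.inr hl₁.le))
      simpa [Real.zero_rpow hl₁.ne'] using hc.tendsto 0
    refine squeeze_zero_norm' ?_ hlim
    filter_upwards [Iio_mem_nhds (zero_lt_one' ℝ)] with s hs
    have hφ1' := hφpos 1 one_pos
    rcases le_or_gt s 0 with h | h
    · rw [slopeFlux_of_nonpos φ h, Real.norm_eq_abs]
      have := Real.rpow_nonneg (abs_nonneg s) l₁
      nlinarith
    · rw [slopeFlux_of_nonneg φ h.le, Real.norm_of_nonneg (mul_pos (hφpos s h) h).le,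
        abs_of_pos h]
      have := mul_le_rpow hφC1 hφpos hφ3 h (le_of_lt hs)
      linarith
  · refine ((hφC1.continuousOn.continuousAt (Ioi_mem_nhds ht)).mul continuousAt_id).congr ?_
    filter_upwards [Ioi_mem_nhds ht] with s hs
    exact (slopeFlux_of_nonneg φ (le_of_lt hs)).symm

theorem exists_inverse_slopeFlux (hφC1 : ContDiffOn ℝ 1 φ (Ioi 0))
    (hφpos : ∀ t > (0:ℝ), 0 < φ t) (hφ1 : ∀ t > (0:ℝ), 0 < deriv (fun s => φ s * s) t)
    (hl₁ : 0 < l₁)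
    (hφ3 : ∀ t > (0:ℝ), l₁ ≤ deriv (fun s => φ s * s) t * t / (φ t * t)) :
    ∃ H : ℝ → ℝ, Continuous H ∧ Monotone H ∧ (∀ y ≤ 0, H y = 0) ∧
      ∀ y, 0 ≤ y → slopeFlux φ (H y) = y := by
  have hmono := strictMono_slopeFlux hφC1 hφpos hφ1
  have htop : Tendsto (slopeFlux φ) atTop atTop := by
    have h1 : Tendsto (fun t : ℝ => φ 1 * t ^ l₁) atTop atTop :=
      (tendsto_rpow_atTop hl₁).const_mul_atTop (hφpos 1 one_pos)
    refine tendsto_atTop_mono' _ ?_ h1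
    filter_upwards [eventually_ge_atTop 1] with t ht
    rw [slopeFlux_of_nonneg φ (by linarith)]
    exact rpow_le_mul hφC1 hφpos hφ3 ht
  have hbot : Tendsto (slopeFlux φ) atBot atBot := by
    refine tendsto_id.congr' ?_
    filter_upwards [eventually_le_atBot 0] with t ht
    exact (slopeFlux_of_nonpos φ ht).symm
  have hsurj := (continuous_slopeFlux hφC1 hφpos hl₁ hφ3).surjective htop hbot
  let e := hmono.orderIsoOfSurjective _ hsurj
  have he : ∀ t, e t = slopeFlux φ t := fun _ => rfl
  have he0 : e.symm 0 = 0 := by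
    rw [OrderIso.symm_apply_eq, he, slopeFlux_of_nonpos φ le_rfl]
  refine ⟨fun y => max (e.symm y) 0, e.symm.continuous.max continuous_const,
    fun x y hxy => max_le_max (e.symm.monotone hxy) le_rfl, fun y hy => ?_, fun y hy => ?_⟩
  · exact max_eq_right (by simpa [he0] using e.symm.monotone hy)
  · change slopeFlux φ (max (e.symm y) 0) = y
    rw [max_eq_left (by simpa [he0] using e.symm.monotone hy), ← he, e.apply_symm_apply]

end

section

variable {φ Φ Φinv : ℝ → ℝ}

theorem primitive_eq (hΦ : ∀ t : ℝ, Φ t = ∫ s in (0:ℝ)..|t|, φ s * s) {t : ℝ} (ht : 0 ≤ t) :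
    Φ t = ∫ s in (0:ℝ)..t, slopeFlux φ s := by
  rw [hΦ, abs_of_nonneg ht]
  refine intervalIntegral.integral_congr fun s hs => ?_
  rw [uIcc_of_le ht] at hs
  exact (slopeFlux_of_nonneg φ hs.1).symm

theorem strictMonoOn_primitive (hΦ : ∀ t : ℝ, Φ t = ∫ s in (0:ℝ)..|t|, φ s * s)
    (hc : Continuous (slopeFlux φ)) (hφpos : ∀ t > (0:ℝ), 0 < φ t) :
    StrictMonoOn Φ (Ici 0) := by
  intro s hs t ht hst
  have hs0 : (0:ℝ) ≤ s := hs
  rw [primitive_eq hΦ hs, primitive_eq hΦ ht, ← sub_pos,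
    intervalIntegral.integral_interval_sub_left (hc.intervalIntegrable _ _)
      (hc.intervalIntegrable _ _)]
  refine intervalIntegral.intervalIntegral_pos_of_pos_on (hc.intervalIntegrable _ _)
    (fun x hx => ?_) hst
  have hx0 : 0 < x := hs0.trans_lt hx.1
  rw [slopeFlux_of_nonneg φ hx0.le]
  exact mul_pos (hφpos x hx0) hx0

theorem monotoneOn_inverse (hmono : StrictMonoOn Φ (Ici 0))
    (hnn : ∀ t ≥ (0:ℝ), 0 ≤ Φinv t) (hright : ∀ t ≥ (0:ℝ), Φ (Φinv t) = t) :
    MonotoneOn Φinv (Ici 0) := by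
  intro x hx y hy hxy
  have hx0 : (0:ℝ) ≤ x := hx
  have hy0 : (0:ℝ) ≤ y := hy
  by_contra! hlt
  have := hmono (hnn y hy0) (hnn x hx0) hlt
  rw [hright x hx0, hright y hy0] at this
  linarith

end

theorem exists_almost_mono {f : ℝ → ℝ} (hf_pos : ∀ s > (0:ℝ), 0 < f s)
    (hf_liminf : 0 < liminf (fun s => sInf (f '' Ici s) / f s) atTop) :
    ∃ c > 0, ∃ s₀, 1 ≤ s₀ ∧ ∀ s t, s₀ ≤ s → s ≤ t → c * f s ≤ f t := by
  have hbdd : ∀ s > (0:ℝ), BddBelow (f '' Ici s) := fun s hs =>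
    ⟨0, by rintro _ ⟨t, ht, rfl⟩; exact (hf_pos t (hs.trans_le ht)).le⟩
  have hlow : IsBoundedUnder (· ≥ ·) atTop (fun s => sInf (f '' Ici s) / f s) := by
    refine ⟨0, ?_⟩
    rw [eventually_map]
    filter_upwards [eventually_gt_atTop 0] with s hs
    refine div_nonneg (Real.sInf_nonneg ?_) (hf_pos s hs).le
    rintro _ ⟨t, ht, rfl⟩
    exact (hf_pos t (lt_of_lt_of_le hs ht)).le
  obtain ⟨c, hc0, hc⟩ := exists_between hf_liminf
  obtain ⟨s₀, hs₀⟩ := eventually_atTop.mp (eventually_lt_of_lt_liminf hc hlow)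
  refine ⟨c, hc0, max s₀ 1, le_max_right _ _, fun s t hs hst => ?_⟩
  have hs0 : 0 < s := one_pos.trans_le ((le_max_right _ _).trans hs)
  have h1 := hs₀ s ((le_max_left _ _).trans hs)
  rw [lt_div_iff₀ (hf_pos s hs0)] at h1
  exact h1.le.trans (csInf_le (hbdd s hs0) ⟨t, hst, rfl⟩)

theorem exists_kellerOsserman {φ Φ Φinv f H : ℝ → ℝ} {m : ℝ}
    (hφpos : ∀ t > (0:ℝ), 0 < φ t) (hm : 1 < m)
    (hΦ : ∀ t : ℝ, Φ t = ∫ s in (0:ℝ)..|t|, φ s * s)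
    (hφ2 : ∀ t > (0:ℝ), φ t * t ^ 2 / Φ t ≤ m)
    (hc : Continuous (slopeFlux φ)) (hmono : StrictMono (slopeFlux φ))
    (hH : ∀ y, 0 ≤ y → slopeFlux φ (H y) = y)
    (hΦinv_nonneg : ∀ t ≥ (0:ℝ), 0 ≤ Φinv t)
    (hΦinv_right : ∀ t ≥ (0:ℝ), Φ (Φinv t) = t)
    (hf_cont : ContinuousOn f (Ici 0)) (hf_pos : ∀ s > (0:ℝ), 0 < f s)
    (hf_liminf : 0 < liminf (fun s => sInf (f '' Ici s) / f s) atTop)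
    (hKO : IntegrableOn (fun t => 1 / Φinv (∫ s in (0:ℝ)..t, f s)) (Ioi 1)) :
    ∃ c C v₀, KellerOsserman (fun t => f (max t 0)) (slopeFlux φ) H
      (fun t => Φinv (∫ s in (0:ℝ)..t, f s)) c C v₀ := by
  obtain ⟨c, hc0, s₀, hs₀, hfm⟩ := exists_almost_mono hf_pos hf_liminf
  have hΦm := strictMonoOn_primitive hΦ hc hφpos
  have hΦ0 : Φ 0 = 0 := by simp [hΦ]
  have hfi : ∀ x y, 0 ≤ x → 0 ≤ y → IntervalIntegrable f volume x y := fun x y hx hy =>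
    (hf_cont.mono fun t ht => (le_min hx hy).trans ht.1).intervalIntegrable
  have hFm : ∀ x y, 0 ≤ x → x < y → ∫ s in (0:ℝ)..x, f s < ∫ s in (0:ℝ)..y, f s := by
    intro x y hx hxy
    rw [← sub_pos, intervalIntegral.integral_interval_sub_left
      (hfi 0 y le_rfl (hx.trans hxy.le)) (hfi 0 x le_rfl hx)]
    exact intervalIntegral.intervalIntegral_pos_of_pos_on (hfi x y hx (hx.trans hxy.le))
      (fun t ht => hf_pos t (hx.trans_lt ht.1)) hxy
  have hF0 : ∀ x, 0 < x → 0 < ∫ s in (0:ℝ)..x, f s := fun x hx => by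
    simpa using hFm 0 x le_rfl hx
  have hGpos : ∀ t, 0 < t → 0 < Φinv (∫ s in (0:ℝ)..t, f s) := fun t ht => by
    refine lt_of_le_of_ne (hΦinv_nonneg _ (hF0 t ht).le) fun h0 => ?_
    have := hΦinv_right _ (hF0 t ht).le
    rw [← h0, hΦ0] at this
    exact (hF0 t ht).ne this
  have hfs₀ : 0 < f s₀ := hf_pos s₀ (by linarith)
  refine ⟨c, m * (2 / c), max (max 2 s₀) ((∫ s in (0:ℝ)..s₀, f s) / f s₀), hmono.monotone, hH,
    hc0, by positivity, (le_max_left _ _).trans (le_max_left _ _), fun v hv => ?_,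
    fun s t hs hst => ?_, fun t ht => hGpos t (by linarith), fun x hx y hy hxy => ?_,
    fun v hv => ?_, hKO⟩
  · have : 2 ≤ v := ((le_max_left _ _).trans (le_max_left _ _)).trans hv
    exact hf_pos _ (by rw [max_eq_left] <;> linarith)
  · have h1 : s₀ ≤ s := ((le_max_right _ _).trans (le_max_left _ _)).trans hs
    rw [max_eq_left (by linarith), max_eq_left (by linarith)]
    exact hfm s t h1 hst
  · have hx1 : (1:ℝ) ≤ x := hx
    have hy1 : (1:ℝ) ≤ y := hy
    refine monotoneOn_inverse hΦm hΦinv_nonneg hΦinv_right (hF0 x (by linarith)).le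
      (hF0 y (by linarith)).le ?_
    rcases hxy.eq_or_lt with rfl | h
    · exact le_rfl
    · exact (hFm x y (by linarith) h).le
  · have hvs : s₀ ≤ v := ((le_max_right _ _).trans (le_max_left _ _)).trans hv
    have hvF : (∫ s in (0:ℝ)..s₀, f s) / f s₀ ≤ v := (le_max_right _ _).trans hv
    have hv0 : 0 < v := by linarith
    rw [div_le_iff₀ hfs₀] at hvF
    simp only [max_eq_left hv0.le]
    set z := Φinv (∫ s in (0:ℝ)..v, f s) with hz
    have hzp : 0 < z := hGpos v hv0
    have hΦz : Φ z = ∫ s in (0:ℝ)..v, f s := hΦinv_right _ (hF0 v hv0).le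
    have h1 : slopeFlux φ z * z ≤ m * ∫ s in (0:ℝ)..v, f s := by
      have := hφ2 z hzp
      rw [hΦz, div_le_iff₀ (hF0 v hv0)] at this
      rw [slopeFlux_of_nonneg φ hzp.le]
      linarith
    have hfv : 0 < f v := hf_pos v hv0
    have h2 : ∫ s in s₀..v, f s ≤ (v - s₀) * (f v / c) := by
      have : ∫ s in s₀..v, f s ≤ ∫ _s in s₀..v, f v / c := by
        refine intervalIntegral.integral_mono_on hvs (hfi _ _ (by linarith) hv0.le) (by simp)
          fun s hs => ?_
        rw [le_div_iff₀ hc0, mul_comm]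
        exact hfm s v hs.1 hs.2
      rwa [intervalIntegral.integral_const, smul_eq_mul] at this
    have h3 := intervalIntegral.integral_add_adjacent_intervals
      (hfi 0 s₀ le_rfl (by linarith)) (hfi s₀ v (by linarith) hv0.le)
    have h4 : f s₀ ≤ f v / c := by
      rw [le_div_iff₀ hc0, mul_comm]; exact hfm s₀ v le_rfl hvs
    have h5 : ∫ s in (0:ℝ)..v, f s ≤ 2 / c * (v * f v) := by
      have e : 2 / c * (v * f v) = 2 * (v * (f v / c)) := by ring
      have h6 : v * f s₀ ≤ v * (f v / c) := mul_le_mul_of_nonneg_left h4 hv0.le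
      have h7 : 0 ≤ s₀ * (f v / c) := by positivity
      rw [e]
      nlinarith
    calc _ ≤ m * ∫ s in (0:ℝ)..v, f s := h1
      _ ≤ m * (2 / c * (v * f v)) := mul_le_mul_of_nonneg_left h5 (by linarith)
      _ = _ := by ring

section Divergence

variable {E : Type*} [NormedAddCommGroup E] [NormedSpace ℝ E] [FiniteDimensional ℝ E]
  [MeasurableSpace E] [BorelSpace E] {μ : Measure E} [μ.IsAddHaarMeasure]

theorem hasDerivAt_integral_mul_comp_smul {G ψ : E → ℝ} (hG : Continuous G)
    (hψ : ContDiff ℝ 1 ψ) (hc : HasCompactSupport ψ) {τ₀ : ℝ} (hτ : 0 < τ₀) :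
    HasDerivAt (fun τ : ℝ => ∫ y, G y * ψ (τ • y) ∂μ)
      (∫ y, G y * fderiv ℝ ψ (τ₀ • y) y ∂μ) τ₀ := by
  obtain ⟨ρ, hρ, hsub⟩ : ∃ ρ > 0, tsupport ψ ⊆ Metric.closedBall 0 ρ := by
    obtain ⟨ρ, hρ⟩ := hc.isCompact.isBounded.subset_closedBall (0 : E)
    exact ⟨max ρ 1, by positivity, hρ.trans (Metric.closedBall_subset_closedBall (le_max_left _ _))⟩
  have hD : Continuous (fderiv ℝ ψ) := hψ.continuous_fderiv one_ne_zero
  have hout : ∀ τ ∈ Ioo (τ₀ / 2) (2 * τ₀), ∀ y ∉ Metric.closedBall (0 : E) (2 * ρ / τ₀),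
      τ • y ∉ tsupport ψ := by
    intro τ hτ' y hy hmem
    have h1 := hsub hmem
    rw [mem_closedBall_zero_iff, norm_smul, Real.norm_of_nonneg (by linarith [hτ'.1])] at h1
    rw [mem_closedBall_zero_iff, not_le, div_lt_iff₀ hτ] at hy
    nlinarith [hτ'.1, norm_nonneg y]
  have hcont : Continuous fun q : ℝ × E => G q.2 * fderiv ℝ ψ (q.1 • q.2) q.2 := by
    refine (hG.comp continuous_snd).mul ?_
    exact (hD.comp (continuous_fst.smul continuous_snd)).clm_apply continuous_snd
  obtain ⟨M, hM⟩ := ((isCompact_Icc (a := τ₀ / 2) (b := 2 * τ₀)).prod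
    (isCompact_closedBall (0 : E) (2 * ρ / τ₀))).exists_bound_of_continuousOn hcont.continuousOn
  have hmem : τ₀ ∈ Ioo (τ₀ / 2) (2 * τ₀) := ⟨by linarith, by linarith⟩
  have hF : ∀ τ : ℝ, Continuous fun y => G y * ψ (τ • y) := fun τ =>
    hG.mul (hψ.continuous.comp (continuous_const_smul τ))
  refine (hasDerivAt_integral_of_dominated_loc_of_deriv_le (μ := μ) (𝕜 := ℝ)
    (F := fun τ y => G y * ψ (τ • y)) (F' := fun τ y => G y * fderiv ℝ ψ (τ • y) y)
    (bound := (Metric.closedBall (0 : E) (2 * ρ / τ₀)).indicator fun _ => M)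
    (Ioo_mem_nhds hmem.1 hmem.2) (Eventually.of_forall fun τ => (hF τ).aestronglyMeasurable)
    ?_ ?_ ?_ ?_ ?_).2
  · refine (hF τ₀).integrable_of_hasCompactSupport
      (HasCompactSupport.intro (isCompact_closedBall (0 : E) (2 * ρ / τ₀)) fun y hy => ?_)
    rw [image_eq_zero_of_notMem_tsupport (hout τ₀ hmem y hy), mul_zero]
  · exact (hcont.comp (Continuous.prodMk_right τ₀)).aestronglyMeasurable
  · refine Eventually.of_forall fun y τ hτ' => ?_
    by_cases hy : y ∈ Metric.closedBall (0 : E) (2 * ρ / τ₀)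
    · rw [indicator_of_mem hy]
      exact hM (τ, y) ⟨Ioo_subset_Icc_self hτ', hy⟩
    · have : fderiv ℝ ψ (τ • y) = 0 := by
        by_contra h
        exact hout τ hτ' y hy (support_fderiv_subset ℝ h)
      simp [indicator_of_notMem hy, this]
  · exact (integrable_indicator_iff measurableSet_closedBall).2
      (integrableOn_const (isCompact_closedBall _ _).measure_ne_top)
  · refine Eventually.of_forall fun y τ _ => ?_
    have h1 : HasDerivAt (fun τ : ℝ => τ • y) y τ := by
      simpa using (hasDerivAt_id τ).smul_const y
    exact (((hψ.differentiable one_ne_zero).differentiableAt.hasFDerivAt.comp_hasDerivAt τ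
      h1)).const_mul (G y)

theorem integral_eq_pow_mul_integral_comp_smul {d : ℕ} (hd : Module.finrank ℝ E = d + 1)
    (g : E → ℝ) {θ : ℝ} (hθ : 0 < θ) :
    ∫ y, g y ∂μ = θ ^ (d + 1) * ∫ x, g (θ • x) ∂μ := by
  rw [Measure.integral_comp_smul, hd, abs_of_pos (by positivity), smul_eq_mul, ← mul_assoc,
    mul_inv_cancel₀ (by positivity), one_mul]

/-- The field `x ↦ (∫₀¹ θ^d G(θx) dθ) x` has weak divergence `G`. -/
theorem integral_radial_field_add {d : ℕ} (hd : Module.finrank ℝ E = d + 1) {G ψ : E → ℝ}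
    (hG : Continuous G) (hψ : ContDiff ℝ 1 ψ) (hc : HasCompactSupport ψ) :
    (∫ x, (∫ θ in (0:ℝ)..1, θ ^ d * G (θ • x)) * fderiv ℝ ψ x x ∂μ) + ∫ x, G x * ψ x ∂μ = 0 := by
  have hD : Continuous (fderiv ℝ ψ) := hψ.continuous_fderiv one_ne_zero
  have hDx : Continuous fun x => fderiv ℝ ψ x x := hD.clm_apply continuous_id
  have hD0 : ∀ x ∉ tsupport ψ, fderiv ℝ ψ x x = 0 := fun x hx => by
    have : fderiv ℝ ψ x = 0 := by
      by_contra h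
      exact hx (support_fderiv_subset ℝ h)
    simp [this]
  have hGs : Continuous fun q : ℝ × E => G (q.1 • q.2) :=
    hG.comp (continuous_fst.smul continuous_snd)
  have hI : Continuous fun θ : ℝ => ∫ x, G (θ • x) * ψ x ∂μ := by
    rw [← continuousOn_univ]
    refine continuousOn_integral_of_compact_support hc.isCompact ?_ ?_
    · exact (hGs.mul (hψ.continuous.comp continuous_snd)).continuousOn
    · intro θ x _ hx
      rw [image_eq_zero_of_notMem_tsupport hx, mul_zero]
  have hJ : Continuous fun θ : ℝ => ∫ x, G (θ • x) * fderiv ℝ ψ x x ∂μ := by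
    rw [← continuousOn_univ]
    refine continuousOn_integral_of_compact_support hc.isCompact ?_ ?_
    · exact (hGs.mul (hDx.comp continuous_snd)).continuousOn
    · intro θ x _ hx
      rw [hD0 x hx, mul_zero]
  have hderiv : ∀ θ ∈ Ioo (0:ℝ) 1,
      HasDerivAt (fun θ : ℝ => θ ^ (d + 1) * ∫ x, G (θ • x) * ψ x ∂μ)
        (-(θ ^ d * ∫ x, G (θ • x) * fderiv ℝ ψ x x ∂μ)) θ := by
    intro θ hθ
    have h0 := hθ.1
    have h1 := (hasDerivAt_integral_mul_comp_smul (μ := μ) hG hψ hc (inv_pos.2 h0)).comp θ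
      (hasDerivAt_inv h0.ne')
    have h2 : (fun θ : ℝ => θ ^ (d + 1) * ∫ x, G (θ • x) * ψ x ∂μ) =ᶠ[nhds θ]
        (fun τ : ℝ => ∫ y, G y * ψ (τ • y) ∂μ) ∘ fun θ => θ⁻¹ := by
      filter_upwards [Ioi_mem_nhds h0] with η hη
      have hη : 0 < η := hη
      simp only [Function.comp_apply]
      rw [integral_eq_pow_mul_integral_comp_smul hd (fun y => G y * ψ (η⁻¹ • y)) hη]
      simp only [smul_smul, inv_mul_cancel₀ hη.ne', one_smul]
    refine (h1.congr_of_eventuallyEq h2).congr_deriv ?_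
    rw [integral_eq_pow_mul_integral_comp_smul hd _ h0]
    simp only [smul_smul, inv_mul_cancel₀ h0.ne', one_smul, map_smul, smul_eq_mul]
    have : ∀ x, G (θ • x) * (θ * fderiv ℝ ψ x x) = θ * (G (θ • x) * fderiv ℝ ψ x x) :=
      fun x => by ring
    simp only [this, integral_const_mul]
    field_simp
    ring
  have hFTC := intervalIntegral.integral_eq_sub_of_hasDerivAt_of_le zero_le_one
    (((continuous_pow (d + 1)).mul hI).continuousOn) hderiv
    (((continuous_pow d).mul hJ).neg.intervalIntegrable 0 1)
  simp only [one_pow, one_smul, one_mul, intervalIntegral.integral_neg, Pi.mul_apply] at hFTC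
  have hswap : (∫ x, (∫ θ in (0:ℝ)..1, θ ^ d * G (θ • x)) * fderiv ℝ ψ x x ∂μ)
      = ∫ θ in (0:ℝ)..1, θ ^ d * ∫ x, G (θ • x) * fderiv ℝ ψ x x ∂μ := by
    have hcont : Continuous fun q : ℝ × E => q.1 ^ d * (G (q.1 • q.2) * fderiv ℝ ψ q.2 q.2) :=
      (continuous_fst.pow d).mul (hGs.mul (hDx.comp continuous_snd))
    have hintegrable : Integrable (fun q : ℝ × E => q.1 ^ d * (G (q.1 • q.2) * fderiv ℝ ψ q.2 q.2))
        ((volume.restrict (Ioc (0:ℝ) 1)).prod μ) := by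
      have h1 : IntegrableOn (fun q : ℝ × E => q.1 ^ d * (G (q.1 • q.2) * fderiv ℝ ψ q.2 q.2))
          (Ioc (0:ℝ) 1 ×ˢ tsupport ψ) (volume.prod μ) :=
        (hcont.continuousOn.integrableOn_compact (isCompact_Icc.prod hc.isCompact)).mono_set
          (prod_mono_left Ioc_subset_Icc_self)
      have h2 : IntegrableOn (fun q : ℝ × E => q.1 ^ d * (G (q.1 • q.2) * fderiv ℝ ψ q.2 q.2))
          (Ioc (0:ℝ) 1 ×ˢ univ) (volume.prod μ) := by
        refine h1.of_forall_sdiff_eq_zero (measurableSet_Ioc.prod MeasurableSet.univ) fun q hq => ?_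
        have : q.2 ∉ tsupport ψ := fun h => hq.2 ⟨hq.1.1, h⟩
        rw [hD0 _ this, mul_zero, mul_zero]
      rwa [IntegrableOn, ← Measure.prod_restrict, Measure.restrict_univ] at h2
    simp only [intervalIntegral.integral_of_le (zero_le_one' ℝ), ← integral_const_mul,
      ← integral_mul_const]
    rw [integral_integral_swap]
    · simp only [mul_assoc]
    · simpa only [mul_assoc, Function.uncurry_def, Function.comp_def, Prod.fst_swap, Prod.snd_swap]
        using hintegrable.swap
  rw [hswap]
  simp at hFTC
  linarith

end Divergence

section Gradient

variable {E : Type*} [NormedAddCommGroup E] [InnerProductSpace ℝ E] [CompleteSpace E]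
  {w p : ℝ → ℝ} {R : ℝ}

theorem hasGradientAt_comp_norm (hw : ∀ r < R, HasDerivAt w (p r) r) (hp : p 0 = 0) {x : E}
    (hx : ‖x‖ < R) : HasGradientAt (fun y : E => w ‖y‖) ((p ‖x‖ / ‖x‖) • x) x := by
  rw [hasGradientAt_iff_hasFDerivAt]
  by_cases h0 : x = 0
  · subst h0
    have h1 := hw 0 (by simpa using hx)
    rw [hp] at h1
    rw [smul_zero, map_zero, hasFDerivAt_iff_isLittleO_nhds_zero]
    have h2 := hasDerivAt_iff_isLittleO_nhds_zero.1 h1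
    have h3 : Tendsto (fun y : E => ‖y‖) (nhds 0) (nhds 0) := by
      simpa using (continuous_norm (E := E)).tendsto 0
    refine Asymptotics.IsLittleO.of_norm_right ?_
    simpa [Function.comp_def] using h2.comp_tendsto h3
  · have hn : 0 < ‖x‖ := norm_pos_iff.2 h0
    have h1 : HasFDerivAt (fun y : E => ‖y‖) (‖x‖⁻¹ • innerSL ℝ x) x := by
      have := ((hasStrictFDerivAt_norm_sq x).hasFDerivAt).sqrt (by positivity)
      simp only [Real.sqrt_sq (norm_nonneg _)] at this
      refine this.congr_fderiv ?_
      ext y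
      simp
      field_simp
    refine ((hw _ hx).comp_hasFDerivAt x h1).congr_fderiv ?_
    ext y
    simp [div_eq_mul_inv, mul_assoc]

theorem contDiffOn_comp_norm (hw : ∀ r < R, HasDerivAt w (p r) r)
    (hpc : ∀ r < R, ContinuousAt p r) (hp : p 0 = 0) :
    ContDiffOn ℝ 1 (fun y : E => w ‖y‖) (Metric.ball 0 R) := by
  have hgrad : ∀ x ∈ Metric.ball (0 : E) R, HasFDerivAt (fun y : E => w ‖y‖)
      (InnerProductSpace.toDual ℝ E ((p ‖x‖ / ‖x‖) • x)) x := fun x hx =>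
    hasGradientAt_iff_hasFDerivAt.1 (hasGradientAt_comp_norm hw hp (mem_ball_zero_iff.1 hx))
  have hcont : ContinuousOn (fun x : E => (p ‖x‖ / ‖x‖) • x) (Metric.ball 0 R) := by
    refine continuousOn_of_forall_continuousAt fun x hx => ?_
    have hpx : ContinuousAt (fun y : E => p ‖y‖) x :=
      ContinuousAt.comp (f := fun y : E => ‖y‖) (hpc _ (mem_ball_zero_iff.1 hx))
        continuous_norm.continuousAt
    by_cases h0 : x = 0
    · subst h0
      rw [ContinuousAt, smul_zero]
      refine squeeze_zero_norm (a := fun y : E => |p ‖y‖|) (fun y => ?_) ?_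
      · rw [norm_smul, Real.norm_eq_abs, abs_div, abs_norm]
        by_cases hy : ‖y‖ = 0
        · simp [hy]
        · rw [div_mul_cancel₀ _ hy]
      · simpa [ContinuousAt, hp] using hpx.abs
    · exact (hpx.div continuous_norm.continuousAt (norm_ne_zero_iff.2 h0)).smul continuousAt_id
  have h1 : (1 : WithTop ℕ∞) = 0 + 1 := by norm_num
  rw [h1, contDiffOn_succ_iff_fderiv_of_isOpen Metric.isOpen_ball]
  refine ⟨fun x hx => (hgrad x hx).differentiableAt.differentiableWithinAt, by simp, ?_⟩
  rw [contDiffOn_zero]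
  refine ((InnerProductSpace.toDual ℝ E).continuous.comp_continuousOn hcont).congr fun x hx => ?_
  exact (hgrad x hx).fderiv

end Gradient

section WeakForm

variable {E : Type*} [NormedAddCommGroup E] [InnerProductSpace ℝ E] [FiniteDimensional ℝ E]
  [MeasurableSpace E] [BorelSpace E] {μ : Measure E} [μ.IsAddHaarMeasure]

theorem weak_form_of_radial_sol {d : ℕ} (hd : Module.finrank ℝ E = d + 1)
    {φ b f H w : ℝ → ℝ} {R : ℝ} (hR : 0 < R) (D : RadialData b f H)
    (hH : ∀ y, 0 ≤ y → slopeFlux φ (H y) = y) (hwc : ContinuousOn w (Iio R))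
    (hw : ∀ r < R, HasDerivAt w (H (flux d (fun t => b t * f (w t)) r)) r) {ψ : E → ℝ}
    (hψ : ContDiff ℝ 1 ψ) (hc : HasCompactSupport ψ) (hsub : tsupport ψ ⊆ Metric.ball 0 R) :
    (∫ x in Metric.ball (0 : E) R, φ ‖gradient (fun y : E => w ‖y‖) x‖ *
        ⟪gradient (fun y : E => w ‖y‖) x, gradient ψ x⟫ ∂μ) +
      (∫ x in Metric.ball (0 : E) R, b ‖x‖ * f (w ‖x‖) * ψ x ∂μ) = 0 := by
  obtain ⟨ρ, hρ, hρsub⟩ := exists_pos_lt_subset_ball hR hc.isCompact.isClosed hsub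
  have hgrad : ∀ x ∈ Metric.ball (0 : E) R,
      φ ‖gradient (fun y : E => w ‖y‖) x‖ * ⟪gradient (fun y : E => w ‖y‖) x, gradient ψ x⟫
        = radialMean d (fun t => b t * f (w t)) ‖x‖ * fderiv ℝ ψ x x := by
    intro x hx
    have hg := (hasGradientAt_comp_norm hw (D.slope_eq_zero w le_rfl)
      (mem_ball_zero_iff.1 hx)).gradient
    rw [hg, real_inner_smul_left, norm_smul, real_inner_comm,
      ← InnerProductSpace.toDual_apply_apply, toDual_gradient, ← mul_assoc]
    by_cases h0 : x = 0
    · simp [h0]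
    have hn : ‖x‖ ≠ 0 := norm_ne_zero_iff.2 h0
    congr 1
    have hp := D.H_nonneg (flux d (fun t => b t * f (w t)) ‖x‖)
    rw [norm_div, norm_norm, div_mul_cancel₀ _ hn, Real.norm_of_nonneg hp, ← mul_div_assoc,
      ← slopeFlux_of_nonneg φ hp, hH _ (flux_nonneg d (D.source_nonneg w) (norm_nonneg x)), flux,
      mul_div_cancel_left₀ _ hn]
  set G : E → ℝ := fun x => b ‖x‖ * f (w (min ‖x‖ ρ)) with hGdef
  have hG : Continuous G := by
    refine (D.b_cont.comp continuous_norm).mul (D.f_cont.comp ?_)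
    exact hwc.comp_continuous (continuous_norm.min continuous_const) fun x =>
      (min_le_right _ _).trans_lt hρ.2
  have hD0 : ∀ x ∉ tsupport ψ, fderiv ℝ ψ x x = 0 := fun x hx => by
    have : fderiv ℝ ψ x = 0 := by
      by_contra h
      exact hx (support_fderiv_subset ℝ h)
    simp [this]
  have key := integral_radial_field_add (μ := μ) hd hG hψ hc
  have h1 : (∫ x in Metric.ball (0 : E) R, φ ‖gradient (fun y : E => w ‖y‖) x‖ *
      ⟪gradient (fun y : E => w ‖y‖) x, gradient ψ x⟫ ∂μ)
      = ∫ x, (∫ θ in (0:ℝ)..1, θ ^ d * G (θ • x)) * fderiv ℝ ψ x x ∂μ := by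
    rw [setIntegral_congr_fun measurableSet_ball hgrad,
      setIntegral_eq_integral_of_forall_compl_eq_zero fun x hx => by
        rw [hD0 x fun h => hx (hsub h), mul_zero]]
    refine integral_congr_ae (Eventually.of_forall fun x => ?_)
    by_cases hx : x ∈ tsupport ψ
    · have hxρ : ‖x‖ < ρ := mem_ball_zero_iff.1 (hρsub hx)
      simp only
      congr 1
      refine intervalIntegral.integral_congr fun θ hθ => ?_
      rw [uIcc_of_le zero_le_one] at hθ
      have hle : ‖x‖ * θ ≤ ρ := by nlinarith [norm_nonneg x, hθ.1, hθ.2]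
      simp [hGdef, norm_smul, abs_of_nonneg hθ.1, mul_comm θ, min_eq_left hle]
    · simp [hD0 x hx]
  have h2 : (∫ x in Metric.ball (0 : E) R, b ‖x‖ * f (w ‖x‖) * ψ x ∂μ) = ∫ x, G x * ψ x ∂μ := by
    rw [setIntegral_eq_integral_of_forall_compl_eq_zero fun x hx => by
      rw [image_eq_zero_of_notMem_tsupport fun h => hx (hsub h), mul_zero]]
    refine integral_congr_ae (Eventually.of_forall fun x => ?_)
    by_cases hx : x ∈ tsupport ψ
    · have hxρ : ‖x‖ < ρ := mem_ball_zero_iff.1 (hρsub hx)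
      simp [hGdef, min_eq_left hxρ.le]
    · simp [image_eq_zero_of_notMem_tsupport hx]
  rw [h1, h2, key]

end WeakForm
theorem exists_radial_profile {E : Type*} [NormedAddCommGroup E] [NormedSpace ℝ E] [Nontrivial E]
    {R : ℝ} (hR : 0 < R) {a : E → ℝ} (ha_cont : ContinuousOn a (Metric.closedBall 0 R))
    (ha_pos : ∀ x ∈ Metric.closedBall (0 : E) R, 0 < a x)
    (ha_rad : ∀ x y : E, ‖x‖ = ‖y‖ → a x = a y) :
    ∃ (b : ℝ → ℝ) (b₀ A : ℝ), Continuous b ∧ 0 < b₀ ∧ (∀ t, b₀ ≤ b t) ∧ (∀ t, b t ≤ A) ∧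
      ∀ x : E, ‖x‖ ≤ R → a x = b ‖x‖ := by
  obtain ⟨e, he⟩ := exists_norm_eq E zero_le_one
  have hnorm : ∀ t, 0 ≤ t → ‖t • e‖ = t := fun t ht => by
    rw [norm_smul, he, mul_one, Real.norm_of_nonneg ht]
  have hk : ContinuousOn (fun t : ℝ => a (t • e)) (Icc 0 R) := by
    refine ha_cont.comp (by fun_prop) fun t ht => ?_
    rw [mem_closedBall_zero_iff, hnorm t ht.1]
    exact ht.2
  have hne : (Icc 0 R).Nonempty := nonempty_Icc.2 hR.le
  obtain ⟨t₀, ht₀, hmin⟩ := isCompact_Icc.exists_isMinOn hne hk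
  obtain ⟨t₁, ht₁, hmax⟩ := isCompact_Icc.exists_isMaxOn hne hk
  refine ⟨fun t => a ((projIcc 0 R hR.le t : ℝ) • e), a (t₀ • e), a (t₁ • e),
    hk.comp_continuous (continuous_subtype_val.comp continuous_projIcc)
      fun t => (projIcc 0 R hR.le t).2, ?_, fun t => hmin (projIcc 0 R hR.le t).2,
    fun t => hmax (projIcc 0 R hR.le t).2, fun x hx => ?_⟩
  · refine ha_pos _ ?_
    rw [mem_closedBall_zero_iff, hnorm t₀ ht₀.1]
    exact ht₀.2
  · refine ha_rad _ _ ?_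
    rw [projIcc_of_mem hR.le ⟨norm_nonneg x, hx⟩, hnorm _ (norm_nonneg x)]

end RadialBlowUp

open RadialBlowUp

/-- Lemma 4.1: under (φ₁)-(φ₃), if a is a positive continuous
radially symmetric function on B̄_R(0) and f is continuous, f(0) = 0, f > 0 on (0,∞),
satisfies (f̲) and the φ-Keller–Osserman condition, then the problem
Δ_φ u = a(x)f(u) in B_R(0), u ≥ 0, u = ∞ on ∂B_R(0), admits a radially symmetric
C¹ solution u(x) = w(|x|) with w'(0) = 0 and w' ≥ 0 on (0,R). -/
theorem stmt13
    (N : ℕ) (hN : 1 ≤ N) (R : ℝ) (hR : 0 < R)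
    (φ Φ Φinv : ℝ → ℝ)
    (hφC1 : ContDiffOn ℝ 1 φ (Set.Ioi 0))
    (hφpos : ∀ t > (0:ℝ), 0 < φ t)
    (hΦ : ∀ t : ℝ, Φ t = ∫ s in (0:ℝ)..|t|, φ s * s)
    (hφ1 : ∀ t > (0:ℝ), 0 < deriv (fun s => φ s * s) t)
    (l m l₁ m₁ : ℝ) (hl : 1 < l) (hm : 1 < m)
    (hφ2 : ∀ t > (0:ℝ), l ≤ φ t * t ^ 2 / Φ t ∧ φ t * t ^ 2 / Φ t ≤ m)
    (hl₁ : 0 < l₁) (hm₁ : 0 < m₁)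
    (hφ3 : ∀ t > (0:ℝ), l₁ ≤ deriv (fun s => φ s * s) t * t / (φ t * t) ∧
      deriv (fun s => φ s * s) t * t / (φ t * t) ≤ m₁)
    (hΦinv_nonneg : ∀ t ≥ (0:ℝ), 0 ≤ Φinv t)
    (hΦinv_left : ∀ t ≥ (0:ℝ), Φinv (Φ t) = t)
    (hΦinv_right : ∀ t ≥ (0:ℝ), Φ (Φinv t) = t)
    (a : EuclideanSpace ℝ (Fin N) → ℝ)
    (ha_cont : ContinuousOn a (Metric.closedBall 0 R))
    (ha_pos : ∀ x ∈ Metric.closedBall (0 : EuclideanSpace ℝ (Fin N)) R, 0 < a x)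
    (ha_rad : ∀ x y : EuclideanSpace ℝ (Fin N), ‖x‖ = ‖y‖ → a x = a y)
    (f : ℝ → ℝ)
    (hf_cont : ContinuousOn f (Set.Ici 0))
    (hf0 : f 0 = 0)
    (hf_pos : ∀ s > (0:ℝ), 0 < f s)
    (hf_liminf : 0 < Filter.liminf (fun s => sInf (f '' Set.Ici s) / f s) Filter.atTop)
    (hKO : IntegrableOn (fun t => 1 / Φinv (∫ s in (0:ℝ)..t, f s)) (Set.Ioi 1)) :
    ∃ w : ℝ → ℝ,
      ContDiffOn ℝ 1 (fun x : EuclideanSpace ℝ (Fin N) => w ‖x‖) (Metric.ball 0 R) ∧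
      (∀ x ∈ Metric.ball (0 : EuclideanSpace ℝ (Fin N)) R, 0 ≤ w ‖x‖) ∧
      (∀ ψ : EuclideanSpace ℝ (Fin N) → ℝ, ContDiff ℝ (⊤ : ℕ∞) ψ → HasCompactSupport ψ →
        tsupport ψ ⊆ Metric.ball 0 R →
        (∫ x in Metric.ball (0 : EuclideanSpace ℝ (Fin N)) R,
            φ ‖gradient (fun y : EuclideanSpace ℝ (Fin N) => w ‖y‖) x‖ *
              ⟪gradient (fun y : EuclideanSpace ℝ (Fin N) => w ‖y‖) x, gradient ψ x⟫) +
          (∫ x in Metric.ball (0 : EuclideanSpace ℝ (Fin N)) R,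
            a x * f (w ‖x‖) * ψ x) = 0) ∧
      (∀ M : ℝ, ∃ δ > (0:ℝ), ∀ x ∈ Metric.ball (0 : EuclideanSpace ℝ (Fin N)) R,
        R - δ < ‖x‖ → M < w ‖x‖) ∧
      derivWithin w (Set.Ici 0) 0 = 0 ∧
      (∀ r : ℝ, 0 < r → r < R → 0 ≤ deriv w r) := by
  obtain ⟨d, rfl⟩ : ∃ d, N = d + 1 := ⟨N - 1, by omega⟩
  have hφ3' := fun t ht => (hφ3 t ht).1
  obtain ⟨H, hHc, hHm, hH0, hH⟩ := exists_inverse_slopeFlux hφC1 hφpos hφ1 hl₁ hφ3'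
  obtain ⟨c, C, v₀, K⟩ := exists_kellerOsserman hφpos hm hΦ (fun t ht => (hφ2 t ht).2)
    (continuous_slopeFlux hφC1 hφpos hl₁ hφ3') (strictMono_slopeFlux hφC1 hφpos hφ1) hH
    hΦinv_nonneg hΦinv_right hf_cont hf_pos hf_liminf hKO
  obtain ⟨b, b₀, A, hbc, hb₀, hb, hA, hab⟩ := exists_radial_profile hR ha_cont ha_pos ha_rad
  have D : RadialData b (fun t => f (max t 0)) H :=
    { b_cont := hbc
      b_nonneg := fun t => hb₀.le.trans (hb t)
      f_cont := hf_cont.comp_continuous (continuous_id.max continuous_const)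
        fun t => le_max_right t 0
      f_nonneg := fun t => by
        rcases (le_max_right t 0).eq_or_lt with h | h
        · rw [← h, hf0]
        · exact (hf_pos _ h).le
      f_zero := by simp [hf0]
      H_cont := hHc
      H_mono := hHm
      H_nonpos := hH0 }
  obtain ⟨w, hwc, hw0, hsol, hblow⟩ := K.exists_blowup D d hb₀ hb hA hR
  have hderiv := fun r (hr : r < R) => (D.hasDerivAt_of_sol hR hwc hsol hr).1
  have hp0 := D.slope_eq_zero (d := d) w le_rfl
  refine ⟨w, contDiffOn_comp_norm hderiv
      (fun r hr => (D.hasDerivAt_of_sol hR hwc hsol hr).2) hp0,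
    fun x hx => hw0 _ (mem_ball_zero_iff.1 hx), fun ψ hψ hc hsub => ?_, fun M => ?_, ?_,
    fun r _ hr => ?_⟩
  · rw [← weak_form_of_radial_sol (μ := volume) (d := d) (by simp) hR D hH hwc hderiv
      (hψ.of_le (by exact_mod_cast le_top)) hc hsub]
    congr 1
    refine setIntegral_congr_fun measurableSet_ball fun x hx => ?_
    have hx' := mem_ball_zero_iff.1 hx
    simp only [hab x hx'.le, max_eq_left (hw0 _ hx')]
  · obtain ⟨δ, hδ, h⟩ := hblow M
    exact ⟨δ, hδ, fun x hx hx' => h _ (mem_ball_zero_iff.1 hx) hx'⟩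
  · have h := hderiv 0 hR
    rw [hp0] at h
    exact h.hasDerivWithinAt.derivWithin (uniqueDiffOn_Ici 0 0 self_mem_Ici)
  · rw [(hderiv r hr).deriv]
    exact D.H_nonneg _
end
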